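/- arXiv:1402.1813 — 3 statements merged into one kernel-verified Lean document; each statement's English description precedes it below -/
import Mathlib

section
/- Every planar graph is 5-choosable; that is, for every planar graph G and every list-assignment L for G with |L(v)| ≥ 5 for every vertex v of G, the graph G has an L-coloring. -/
open Set Topology

/-- A plane embedding (drawing) of a simple graph: vertices are distinct points of the
plane and each edge is drawn as a simple arc joining the images of its endpoints;
an arc passes through no vertex other than its endpoints, and two distinct arcs
meet only at images of common endpoints. -/
structure PlaneEmbedding {V : Type*} (G : SimpleGraph V) where
  pos : V → ℝ × ℝ
  arc : Sym2 V → Set (ℝ × ℝ)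
  pos_inj : Function.Injective pos
  arc_is_arc : ∀ e ∈ G.edgeSet, ∃ γ : ℝ → ℝ × ℝ,
    ContinuousOn γ (Icc 0 1) ∧ InjOn γ (Icc 0 1) ∧ γ '' (Icc 0 1) = arc e ∧
    ∀ u v : V, e = s(u, v) → ({γ 0, γ 1} : Set (ℝ × ℝ)) = {pos u, pos v}
  arc_inter_pos : ∀ e ∈ G.edgeSet, ∀ v : V, pos v ∈ arc e → v ∈ e
  arc_inter_arc : ∀ e ∈ G.edgeSet, ∀ f ∈ G.edgeSet, e ≠ f →
    ∀ p ∈ arc e ∩ arc f, ∃ v : V, v ∈ e ∧ v ∈ f ∧ pos v = p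

namespace PlaneEmbedding

variable {V : Type*} {G : SimpleGraph V} (E : PlaneEmbedding G)

/-- The point set of the drawing. -/
def image : Set (ℝ × ℝ) := Set.range E.pos ∪ ⋃ e ∈ G.edgeSet, E.arc e

/-- The outer (unbounded) face: the set of points of the complement of the drawing
whose connected component in the complement is unbounded. -/
def outerFace : Set (ℝ × ℝ) :=
  {x | x ∉ E.image ∧ ¬ Bornology.IsBounded (connectedComponentIn E.imageᶜ x)}

/-- A vertex is incident with the outer face if its image lies in the closure of
the outer face. -/
def IncOuter (v : V) : Prop := E.pos v ∈ closure E.outerFace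

/-- `C` is the outer cycle of the drawing: a cycle in `G` whose drawing is exactly
the boundary of the outer face. -/
def IsOuterCycle {w : V} (C : G.Walk w w) : Prop :=
  C.IsCycle ∧ (⋃ e ∈ C.edges, E.arc e) = frontier E.outerFace

end PlaneEmbedding

/-- `φ` is a proper coloring of `G` from the lists `L`. -/
def IsLColoring {V : Type*} (G : SimpleGraph V) (L : V → Finset ℕ) (φ : V → ℕ) : Prop :=
  (∀ v : V, φ v ∈ L v) ∧ ∀ ⦃u w : V⦄, G.Adj u w → φ u ≠ φ w

/-- `(G, S, L)` (with drawing `E`) is a canvas: `S` is a subgraph of the boundary of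
the outer face, lists are nonempty, have size at least `5` off the outer face, size
at least `3` outside `S`, and `S` has a proper `L`-coloring. -/
def IsCanvas {V : Type*} (G : SimpleGraph V) (E : PlaneEmbedding G) (S : G.Subgraph)
    (L : V → Finset ℕ) : Prop :=
  (∀ v : V, (L v).Nonempty) ∧
  (∀ v ∈ S.verts, E.pos v ∈ frontier E.outerFace) ∧
  (∀ e ∈ S.edgeSet, E.arc e ⊆ frontier E.outerFace) ∧
  (∀ v : V, ¬ E.IncOuter v → 5 ≤ (L v).card) ∧
  (∀ v : V, v ∉ S.verts → 3 ≤ (L v).card) ∧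
  (∃ φ : V → ℕ, (∀ v ∈ S.verts, φ v ∈ L v) ∧ ∀ ⦃x y : V⦄, S.Adj x y → φ x ≠ φ y)

/-- A canvas is critical if `G` is not `L`-colorable but deleting any edge not in `S`
yields an `L`-colorable graph. -/
def IsCritical {V : Type*} (G : SimpleGraph V) (S : SimpleGraph.Subgraph G)
    (L : V → Finset ℕ) : Prop :=
  (¬ ∃ φ : V → ℕ, IsLColoring G L φ) ∧
  ∀ e ∈ G.edgeSet, e ∉ S.edgeSet →
    ∃ φ : V → ℕ, IsLColoring (G.deleteEdges {e}) L φ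

/-- `v` is a cutvertex of `G`: some two vertices distinct from `v` are connected in
`G`, but every walk between them passes through `v`. -/
def IsCutvertex {V : Type*} (G : SimpleGraph V) (v : V) : Prop :=
  ∃ x y : V, x ≠ v ∧ y ≠ v ∧ G.Reachable x y ∧ ∀ W : G.Walk x y, v ∈ W.support

/-- `G` is 2-connected: connected with no cutvertex. -/
def TwoConnected {V : Type*} (G : SimpleGraph V) : Prop :=
  G.Connected ∧ ∀ v : V, ¬ IsCutvertex G v

/-- The edge `uv` is a chord of the outer walk of the drawing `E`: an edge of `G`
joining two vertices on the boundary of the outer face that is not itself drawn on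
that boundary. -/
def IsChord {V : Type*} {G : SimpleGraph V} (E : PlaneEmbedding G) (u v : V) : Prop :=
  G.Adj u v ∧ E.pos u ∈ frontier E.outerFace ∧ E.pos v ∈ frontier E.outerFace ∧
    ¬ E.arc s(u, v) ⊆ frontier E.outerFace

/-- A cutvertex `v` is essential (with respect to `S`) if whenever `G = G₁ ∪ G₂` with
`V(G₁), V(G₂) ≠ V(G)` and `V(G₁) ∩ V(G₂) = {v}`, neither `Gᵢ` contains all of `V(S)`. -/
def EssentialCutvertex {V : Type*} (G : SimpleGraph V) (S : SimpleGraph.Subgraph G)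
    (v : V) : Prop :=
  ∀ H₁ H₂ : SimpleGraph.Subgraph G, H₁ ⊔ H₂ = ⊤ →
    H₁.verts ≠ Set.univ → H₂.verts ≠ Set.univ → H₁.verts ∩ H₂.verts = {v} →
    ¬ S.verts ⊆ H₁.verts ∧ ¬ S.verts ⊆ H₂.verts

/-- A chord `uv` is essential (with respect to `S`) if whenever `G = G₁ ∪ G₂` with
`V(G₁), V(G₂) ≠ V(G)` and `V(G₁) ∩ V(G₂) = {u, v}`, neither `Gᵢ` contains all of `V(S)`. -/
def EssentialChord {V : Type*} (G : SimpleGraph V) (S : SimpleGraph.Subgraph G)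
    (u v : V) : Prop :=
  ∀ H₁ H₂ : SimpleGraph.Subgraph G, H₁ ⊔ H₂ = ⊤ →
    H₁.verts ≠ Set.univ → H₂.verts ≠ Set.univ → H₁.verts ∩ H₂.verts = {u, v} →
    ¬ S.verts ⊆ H₁.verts ∧ ¬ S.verts ⊆ H₂.verts

/-- The edge `xy` of `G` separates `s` from `t`: `s` and `t` lie in different
components of `G ∖ {x, y}`. -/
def SeparatesEdge {V : Type*} (G : SimpleGraph V) (x y s t : V) : Prop :=
  s ≠ x ∧ s ≠ y ∧ t ≠ x ∧ t ≠ y ∧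
    ∀ W : G.Walk s t, x ∈ W.support ∨ y ∈ W.support


namespace FiveChoose

/-- A nowhere vanishing continuous map from a contractible nice space has a continuous logarithm. -/
lemma exists_log {A : Type*} [TopologicalSpace A] [SimplyConnectedSpace A]
    [LocallyPathConnectedSpace A] (g : A → ℂ) (hg : Continuous g) (h0 : ∀ a, g a ≠ 0) :
    ∃ F : A → ℂ, Continuous F ∧ ∀ a, Complex.exp (F a) = g a := by
  obtain ⟨a₀⟩ : Nonempty A := inferInstance
  obtain ⟨F, ⟨-, hF⟩, -⟩ := Complex.isCoveringMapOn_exp.existsUnique_continuousMap_lifts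
    (⟨g, hg⟩ : C(A, ℂ)) (a₀ := a₀) (e₀ := Complex.log (g a₀)) (by simp [Complex.exp_log (h0 a₀)])
    (fun a => by simpa using h0 a)
  exact ⟨F, F.continuous, fun a => congrFun hF a⟩

/-- Two continuous logarithms of the same curve have the same increment. -/
lemma log_increment_unique (F₁ F₂ : ℝ → ℂ) (h₁ : Continuous F₁) (h₂ : Continuous F₂)
    (h : ∀ t, Complex.exp (F₁ t) = Complex.exp (F₂ t)) : F₁ 1 - F₁ 0 = F₂ 1 - F₂ 0 := by
  have hz : Complex.exp (F₁ 0 - F₂ 0) = 1 := by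
    rw [Complex.exp_sub, h, div_self (Complex.exp_ne_zero _)]
  have key : F₁ = fun t => F₂ t + (F₁ 0 - F₂ 0) := by
    have cov := Complex.isCoveringMap_exp
    refine cov.eq_of_comp_eq h₁ (by fun_prop) ?_ 0 (by ring)
    funext t
    simp only [Function.comp, Subtype.mk.injEq]
    rw [Complex.exp_add, hz, mul_one, h]
  have := congrFun key 1
  rw [this]; ring

/-- There is no drawing of `K₅` in the plane in which disjoint edges are disjoint. -/
lemma no_K5_curves (f : Fin 5 → ℂ) (c : Fin 5 → Fin 5 → ℝ → ℂ)
    (hc : ∀ i j, i < j → Continuous (c i j))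
    (h0 : ∀ i j, i < j → c i j 0 = f i) (h1 : ∀ i j, i < j → c i j 1 = f j)
    (hd : ∀ i j k l, i < j → k < l → i ≠ k → i ≠ l → j ≠ k → j ≠ l →
      ∀ s t, c i j s ≠ c k l t) : False := by
  -- points are off disjoint curves
  have hoff : ∀ k i j, i < j → k ≠ i → k ≠ j → ∀ t, c i j t ≠ f k := by
    intro k i j hij hki hkj t
    obtain ⟨l, hl⟩ : ∃ l : Fin 5, l ≠ k ∧ l ≠ i ∧ l ≠ j := by
      revert k i j; decide
    obtain ⟨hlk, hli, hlj⟩ := hl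
    rcases lt_or_gt_of_ne hlk with h | h
    · rw [← h1 l k h]; exact hd i j l k hij h hli.symm hki.symm hlj.symm hkj.symm t 1
    · rw [← h0 k l h]; exact hd i j k l hij h hki.symm hli.symm hkj.symm hlj.symm t 0
  have hinj : ∀ a b, a < b → f b - f a ≠ 0 := by
    intro a b hab
    obtain ⟨l, hl⟩ : ∃ l : Fin 5, l ≠ a ∧ l ≠ b := by
      revert a b; decide
    obtain ⟨hla, hlb⟩ := hl
    rw [sub_ne_zero]
    rcases lt_or_gt_of_ne hla with h | h
    · rw [← h1 l a h]; exact (hoff b l a h hlb.symm hab.ne' 1).symm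
    · rw [← h0 a l h]; exact (hoff b a l h hab.ne' hlb.symm 0).symm
  let lam : Fin 5 → Fin 5 → ℂ := fun a b =>
    if a < b then Complex.log (f b - f a) else Complex.log (f a - f b) + Real.pi * Complex.I
  have hlam : ∀ a b, a ≠ b → Complex.exp (lam a b) = f b - f a := by
    intro a b hab
    by_cases h : a < b
    · simp only [lam, if_pos h]; exact Complex.exp_log (hinj a b h)
    · have h' : b < a := lt_of_le_of_ne (not_lt.mp h) hab.symm
      simp only [lam, if_neg h]
      rw [Complex.exp_add, Complex.exp_pi_mul_I, Complex.exp_log (hinj b a h')]; ring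
  let eps : Fin 5 → Fin 5 → ℤ := fun a b => if a < b then -1 else 1
  have heps : ∀ a b, a ≠ b → lam a b - lam b a = eps a b * (Real.pi * Complex.I) := by
    intro a b hab
    rcases lt_or_gt_of_ne hab with h | h
    · simp only [lam, eps, if_pos h, if_neg (not_lt.mpr h.le)]; push_cast; ring
    · simp only [lam, eps, if_pos h, if_neg (not_lt.mpr h.le)]; push_cast; ring
  have hn : ∀ k i j, ∃ n : ℤ, i < j → k ≠ i → k ≠ j → ∀ F : ℝ → ℂ, Continuous F →
      ((∀ t, Complex.exp (F t) = c i j t - f k) ∨ (∀ t, Complex.exp (F t) = f k - c i j t)) →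
      F 1 - F 0 = lam k j - lam k i + n * (2 * Real.pi * Complex.I) := by
    intro k i j
    by_cases hh : i < j ∧ k ≠ i ∧ k ≠ j
    swap
    · exact ⟨0, fun a b c => (hh ⟨a, b, c⟩).elim⟩
    obtain ⟨hij, hki, hkj⟩ := hh
    obtain ⟨F₀, hF₀, hF₀e⟩ := exists_log (fun t => c i j t - f k)
      ((hc i j hij).sub continuous_const) (fun t => sub_ne_zero.mpr (hoff k i j hij hki hkj t))
    have e : Complex.exp (F₀ 1 - F₀ 0) = Complex.exp (lam k j - lam k i) := by
      rw [Complex.exp_sub, Complex.exp_sub, hF₀e, hF₀e, hlam k j hkj, hlam k i hki,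
        h0 i j hij, h1 i j hij]
    obtain ⟨n, hn⟩ := Complex.exp_eq_exp_iff_exists_int.mp e
    refine ⟨n, fun _ _ _ F hF hFe => ?_⟩
    rw [← hn]
    rcases hFe with hFe | hFe
    · exact log_increment_unique _ _ hF hF₀ (fun t => by rw [hFe, hF₀e])
    · have := log_increment_unique (fun t => F t + Real.pi * Complex.I) F₀ (by fun_prop) hF₀
        (fun t => by rw [Complex.exp_add, Complex.exp_pi_mul_I, hFe, hF₀e]; ring)
      rw [← this]; ring
  choose n hn using hn
  have sq : ∀ i j k l, i < j → k < l → i ≠ k → i ≠ l → j ≠ k → j ≠ l →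
      eps k j + eps i k + eps j l + eps l i
        + 2 * (n k i j + n j k l - n i k l - n l i j) = 0 := by
    intro i j k l hij hkl hik hil hjk hjl
    obtain ⟨H, hH, hHe⟩ := exists_log (fun p : ℝ × ℝ => c i j p.1 - c k l p.2)
      (((hc i j hij).comp continuous_fst).sub ((hc k l hkl).comp continuous_snd))
      (fun p => sub_ne_zero.mpr (hd i j k l hij hkl hik hil hjk hjl p.1 p.2))
    have e1 := hn k i j hij hik.symm hjk.symm (fun t => H (t, 0)) (by fun_prop)
      (Or.inl fun t => by rw [hHe]; simp [h0 k l hkl])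
    have e2 := hn l i j hij hil.symm hjl.symm (fun t => H (t, 1)) (by fun_prop)
      (Or.inl fun t => by rw [hHe]; simp [h1 k l hkl])
    have e3 := hn i k l hkl hik hil (fun t => H (0, t)) (by fun_prop)
      (Or.inr fun t => by rw [hHe]; simp [h0 i j hij])
    have e4 := hn j k l hkl hjk hjl (fun t => H (1, t)) (by fun_prop)
      (Or.inr fun t => by rw [hHe]; simp [h1 i j hij])
    have a1 := heps k j hjk.symm
    have a2 := heps i k hik
    have a3 := heps j l hjl
    have a4 := heps l i hil.symm
    have hpi : (Real.pi : ℂ) * Complex.I ≠ 0 :=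
      mul_ne_zero (by exact_mod_cast Real.pi_ne_zero) Complex.I_ne_zero
    have : ((eps k j + eps i k + eps j l + eps l i
        + 2 * (n k i j + n j k l - n i k l - n l i j) : ℤ) : ℂ) * (Real.pi * Complex.I) = 0 := by
      push_cast
      linear_combination -a1 - a2 - a3 - a4 - e1 - e4 + e3 + e2
    rcases mul_eq_zero.mp this with h | h
    · exact_mod_cast h
    · exact (hpi h).elim
  have q1 := sq 0 1 2 3 (by decide) (by decide) (by decide) (by decide) (by decide) (by decide)
  have q2 := sq 0 2 1 3 (by decide) (by decide) (by decide) (by decide) (by decide) (by decide)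
  have q3 := sq 0 3 1 2 (by decide) (by decide) (by decide) (by decide) (by decide) (by decide)
  have q4 := sq 0 1 2 4 (by decide) (by decide) (by decide) (by decide) (by decide) (by decide)
  have q5 := sq 0 2 1 4 (by decide) (by decide) (by decide) (by decide) (by decide) (by decide)
  have q6 := sq 0 4 1 2 (by decide) (by decide) (by decide) (by decide) (by decide) (by decide)
  have q7 := sq 0 1 3 4 (by decide) (by decide) (by decide) (by decide) (by decide) (by decide)
  have q8 := sq 0 3 1 4 (by decide) (by decide) (by decide) (by decide) (by decide) (by decide)
  have q9 := sq 0 4 1 3 (by decide) (by decide) (by decide) (by decide) (by decide) (by decide)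
  have r1 := sq 0 2 3 4 (by decide) (by decide) (by decide) (by decide) (by decide) (by decide)
  have r2 := sq 0 3 2 4 (by decide) (by decide) (by decide) (by decide) (by decide) (by decide)
  have r3 := sq 0 4 2 3 (by decide) (by decide) (by decide) (by decide) (by decide) (by decide)
  have r4 := sq 1 2 3 4 (by decide) (by decide) (by decide) (by decide) (by decide) (by decide)
  have r5 := sq 1 3 2 4 (by decide) (by decide) (by decide) (by decide) (by decide) (by decide)
  have r6 := sq 1 4 2 3 (by decide) (by decide) (by decide) (by decide) (by decide) (by decide)
  simp only [eps, show ((0 : Fin 5) < 1) = True from by decide, Fin.reduceLT, if_true, if_false]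
    at q1 q2 q3 q4 q5 q6 q7 q8 q9 r1 r2 r3 r4 r5 r6
  clear sq hn hoff hinj hlam heps
  omega

variable {V : Type*} {G : SimpleGraph V}

/-- The part of the drawing spanned by a set of vertices. -/
def region (E : PlaneEmbedding G) (S : Set V) : Set (ℝ × ℝ) :=
  E.pos '' S ∪ ⋃ e ∈ {e | e ∈ G.edgeSet ∧ ∀ v ∈ e, v ∈ S}, E.arc e

lemma region_disjoint (E : PlaneEmbedding G) {S T : Set V} (h : Disjoint S T) :
    ∀ p ∈ region E S, p ∉ region E T := by
  rw [Set.disjoint_left] at h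
  rintro p hp hq
  simp only [region, mem_union, mem_image, mem_iUnion, mem_ofPred_eq, exists_prop] at hp hq
  rcases hp with ⟨u, hu, rfl⟩ | ⟨e, ⟨he, heS⟩, hpe⟩
  · rcases hq with ⟨v, hv, hvu⟩ | ⟨e', ⟨he', heT⟩, hpe'⟩
    · exact h hu (E.pos_inj hvu ▸ hv)
    · exact h hu (heT _ (E.arc_inter_pos _ he' _ hpe'))
  · rcases hq with ⟨v, hv, rfl⟩ | ⟨e', ⟨he', heT⟩, hpe'⟩
    · exact h (heS _ (E.arc_inter_pos _ he _ hpe)) hv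
    · by_cases hee : e = e'
      · subst hee
        induction e using Sym2.ind with
        | _ x y => exact h (heS x (by simp)) (heT x (by simp))
      · obtain ⟨v, hv, hv', -⟩ := E.arc_inter_arc e he e' he' hee p ⟨hpe, hpe'⟩
        exact h (heS v hv) (heT v hv')

lemma joinedIn_edge (E : PlaneEmbedding G) {u v : V} (h : G.Adj u v) :
    JoinedIn (E.arc s(u, v)) (E.pos u) (E.pos v) := by
  obtain ⟨γ, hγ, -, him, hends⟩ := E.arc_is_arc s(u, v) h
  have hj : JoinedIn (E.arc s(u, v)) (γ 0) (γ 1) := by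
    refine JoinedIn.ofLine (f := γ) hγ rfl rfl him.le
  have hne : E.pos u ≠ E.pos v := fun hh => h.ne (E.pos_inj hh)
  have he := hends u v rfl
  have hu : E.pos u ∈ ({γ 0, γ 1} : Set (ℝ × ℝ)) := by rw [he]; simp
  have hv : E.pos v ∈ ({γ 0, γ 1} : Set (ℝ × ℝ)) := by rw [he]; simp
  simp only [mem_insert_iff, mem_singleton_iff] at hu hv
  rcases hu with hu | hu <;> rcases hv with hv | hv
  · exact (hne (hu.trans hv.symm)).elim
  · rw [hu, hv]; exact hj
  · rw [hu, hv]; exact hj.symm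
  · exact (hne (hu.trans hv.symm)).elim

/-- `u` and `v` are joined by a walk of `G` inside `S`. -/
def Conn (G : SimpleGraph V) (S : Set V) (u v : V) : Prop :=
  ∃ p : G.Walk u v, ∀ x ∈ p.support, x ∈ S

lemma Conn.joinedIn (E : PlaneEmbedding G) {S : Set V} {u v : V} (h : Conn G S u v) :
    JoinedIn (region E S) (E.pos u) (E.pos v) := by
  obtain ⟨p, hp⟩ := h
  induction p with
  | nil => exact JoinedIn.refl (Or.inl ⟨_, hp _ (by simp), rfl⟩)
  | @cons a b d hab q ih =>
    refine JoinedIn.trans ((joinedIn_edge E hab).mono ?_) (ih fun x hx => hp x (by simp [hx]))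
    intro z hz
    refine Or.inr ?_
    simp only [mem_iUnion, mem_ofPred_eq, exists_prop]
    refine ⟨s(a, b), ⟨hab, ?_⟩, hz⟩
    intro x hx
    simp only [Sym2.mem_iff] at hx
    rcases hx with rfl | rfl
    · exact hp _ (by simp)
    · exact hp _ (by simp)

/-- A planar graph has no `K₅`-like configuration of connections. -/
lemma no_K5 (E : PlaneEmbedding G) (v : Fin 5 → V) (S : Fin 5 → Fin 5 → Set V)
    (hj : ∀ i j, i < j → Conn G (S i j) (v i) (v j))
    (hd : ∀ i j k l, i < j → k < l → i ≠ k → i ≠ l → j ≠ k → j ≠ l →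
      Disjoint (S i j) (S k l)) : False := by
  have hp : ∀ i j, ∃ c : ℝ → ℂ, i < j → Continuous c ∧
      c 0 = Complex.equivRealProdCLM.symm (E.pos (v i)) ∧
      c 1 = Complex.equivRealProdCLM.symm (E.pos (v j)) ∧
      ∀ t, Complex.equivRealProdCLM (c t) ∈ region E (S i j) := by
    intro i j
    by_cases hij : i < j
    · obtain ⟨γ, hγ⟩ := (hj i j hij).joinedIn E
      refine ⟨fun t => Complex.equivRealProdCLM.symm (γ.extend t), fun _ => ⟨?_, ?_, ?_, ?_⟩⟩
      · exact Complex.equivRealProdCLM.symm.continuous.comp γ.continuous_extend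
      · simp
      · simp
      · intro t
        simp only [ContinuousLinearEquiv.apply_symm_apply]
        exact hγ _
    · exact ⟨fun _ => 0, fun h => (hij h).elim⟩
  choose c hc using hp
  refine no_K5_curves (fun i => Complex.equivRealProdCLM.symm (E.pos (v i))) c
    (fun i j h => (hc i j h).1) (fun i j h => (hc i j h).2.1) (fun i j h => (hc i j h).2.2.1) ?_
  intro i j k l hij hkl h1 h2 h3 h4 s t hst
  refine region_disjoint E (hd i j k l hij hkl h1 h2 h3 h4) _ ((hc i j hij).2.2.2 s) ?_
  rw [hst]
  exact (hc k l hkl).2.2.2 t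

/-- `v` has a neighbour in the (contracted) set `A`. -/
def Bd (G : SimpleGraph V) (A : Set V) (v : V) : Prop := ∃ a ∈ A, G.Adj a v

lemma Conn.mono {S T : Set V} (h : S ⊆ T) {u v : V} (hc : Conn G S u v) : Conn G T u v := by
  obtain ⟨p, hp⟩ := hc
  exact ⟨p, fun x hx => h (hp x hx)⟩

lemma Conn.trans {S : Set V} {u v w : V} (h : Conn G S u v) (h' : Conn G S v w) :
    Conn G S u w := by
  obtain ⟨p, hp⟩ := h
  obtain ⟨q, hq⟩ := h'
  refine ⟨p.append q, fun x hx => ?_⟩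
  rcases SimpleGraph.Walk.mem_support_append_iff _ _ |>.mp hx with h | h
  · exact hp x h
  · exact hq x h

lemma Conn.symm {S : Set V} {u v : V} (h : Conn G S u v) : Conn G S v u := by
  obtain ⟨p, hp⟩ := h
  exact ⟨p.reverse, fun x hx => hp x (by simpa using hx)⟩

lemma Conn.refl {S : Set V} {u : V} (h : u ∈ S) : Conn G S u u :=
  ⟨.nil, fun x hx => by simp at hx; exact hx ▸ h⟩

lemma Conn.edge {S : Set V} {u v : V} (h : G.Adj u v) (hu : u ∈ S) (hv : v ∈ S) :
    Conn G S u v :=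
  ⟨h.toWalk, fun x hx => by
    simp at hx
    rcases hx with rfl | rfl <;> assumption⟩

lemma Conn.mem_right {S : Set V} {u v : V} (h : Conn G S u v) : v ∈ S := by
  obtain ⟨p, hp⟩ := h
  exact hp v (by simp)

/-- The forbidden configuration: the vertex `w` together with the connected set `A` and
three common neighbours pairwise joined off the rest. -/
lemma no_config (E : PlaneEmbedding G) {A R : Set V} (hA : ∀ a ∈ A, ∀ b ∈ A, Conn G A a b)
    (hR : ∀ v ∈ R, v ∉ A) {w x y z : V} (hw : w ∈ R) (hx : x ∈ R) (hy : y ∈ R) (hz : z ∈ R)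
    (bw : Bd G A w) (bx : Bd G A x) (bdy : Bd G A y) (bz : Bd G A z)
    (ax : G.Adj w x) (ay : G.Adj w y) (az : G.Adj w z)
    (hxy : x ≠ y) (hxz : x ≠ z) (hyz : y ≠ z)
    (cz : Conn G (R \ {w, z}) x y) (cy : Conn G (R \ {w, y}) x z)
    (cx : Conn G (R \ {w, x}) y z) : False := by
  obtain ⟨a₀, ha₀, -⟩ := id bw
  have hB : ∀ v, Bd G A v → Conn G (insert v A) v a₀ := by
    rintro v ⟨a, ha, hav⟩
    exact (Conn.edge hav.symm (by simp) (by simp [ha])).trans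
      ((hA a ha a₀ ha₀).mono (Set.subset_insert _ _))
  have hwx := ax.ne
  have hwy := ay.ne
  have hwz := az.ne
  have nw := hR w hw
  have nx := hR x hx
  have ny := hR y hy
  have nz := hR z hz
  have enum2 : ∀ i j : Fin 5, i < j → (i, j) ∈ ([(0,1),(0,2),(0,3),(0,4),(1,2),(1,3),(1,4),
      (2,3),(2,4),(3,4)] : List (Fin 5 × Fin 5)) := by decide
  have enum4 : ∀ i j k l : Fin 5, i < j → k < l → i ≠ k → i ≠ l → j ≠ k → j ≠ l → i < k →
      (i, j, k, l) ∈ ([(0,1,2,3),(0,2,1,3),(0,3,1,2),(0,1,2,4),(0,2,1,4),(0,4,1,2),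
        (0,1,3,4),(0,3,1,4),(0,4,1,3),(0,2,3,4),(0,3,2,4),(0,4,2,3),
        (1,2,3,4),(1,3,2,4),(1,4,2,3)] : List (Fin 5 × Fin 5 × Fin 5 × Fin 5)) := by decide
  let S : Fin 5 → Fin 5 → Set V := ![![∅, {w, x}, {w, y}, {w, z}, insert w A],
    ![∅, ∅, R \ {w, z}, R \ {w, y}, insert x A],
    ![∅, ∅, ∅, R \ {w, x}, insert y A],
    ![∅, ∅, ∅, ∅, insert z A],
    ![∅, ∅, ∅, ∅, ∅]]
  refine no_K5 E ![w, x, y, z, a₀] S ?_ ?_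
  · intro i j hij
    have := enum2 i j hij
    simp only [List.mem_cons, Prod.mk.injEq, List.not_mem_nil, or_false] at this
    rcases this with ⟨rfl, rfl⟩ | ⟨rfl, rfl⟩ | ⟨rfl, rfl⟩ | ⟨rfl, rfl⟩ | ⟨rfl, rfl⟩ | ⟨rfl, rfl⟩ |
      ⟨rfl, rfl⟩ | ⟨rfl, rfl⟩ | ⟨rfl, rfl⟩ | ⟨rfl, rfl⟩
    · exact Conn.edge ax (by simp [S]) (by simp [S])
    · exact Conn.edge ay (by simp [S]) (by simp [S])
    · exact Conn.edge az (by simp [S]) (by simp [S])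
    · exact hB w bw
    · exact cz
    · exact cy
    · exact hB x bx
    · exact cx
    · exact hB y bdy
    · exact hB z bz
  · have main : ∀ i j k l, i < j → k < l → i ≠ k → i ≠ l → j ≠ k → j ≠ l → i < k →
        Disjoint (S i j) (S k l) := by
      intro i j k l h1 h2 h3 h4 h5 h6 h7
      have := enum4 i j k l h1 h2 h3 h4 h5 h6 h7
      clear h1 h2 h3 h4 h5 h6 h7
      rw [Set.disjoint_left]
      intro u
      simp only [List.mem_cons, Prod.mk.injEq, List.not_mem_nil, or_false] at this
      have hu := hR u
      rcases this with ⟨rfl, rfl, rfl, rfl⟩ | ⟨rfl, rfl, rfl, rfl⟩ | ⟨rfl, rfl, rfl, rfl⟩ |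
        ⟨rfl, rfl, rfl, rfl⟩ | ⟨rfl, rfl, rfl, rfl⟩ | ⟨rfl, rfl, rfl, rfl⟩ |
        ⟨rfl, rfl, rfl, rfl⟩ | ⟨rfl, rfl, rfl, rfl⟩ | ⟨rfl, rfl, rfl, rfl⟩ |
        ⟨rfl, rfl, rfl, rfl⟩ | ⟨rfl, rfl, rfl, rfl⟩ | ⟨rfl, rfl, rfl, rfl⟩ |
        ⟨rfl, rfl, rfl, rfl⟩ | ⟨rfl, rfl, rfl, rfl⟩ | ⟨rfl, rfl, rfl, rfl⟩ <;>
      · simp [S]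
        grind
    intro i j k l h1 h2 h3 h4 h5 h6
    rcases lt_or_gt_of_ne h3 with h | h
    · exact main i j k l h1 h2 h3 h4 h5 h6 h
    · exact (main k l i j h2 h1 h3.symm h5.symm h4.symm h6.symm h).symm

/-- `A` is connected and disjoint from the set `R` of vertices still to be coloured. -/
def Base (G : SimpleGraph V) (A : Set V) (R : Finset V) : Prop :=
  (∀ v ∈ R, v ∉ A) ∧ ∀ a ∈ A, ∀ b ∈ A, Conn G A a b

/-- List sizes, outside the precoloured set `P`. -/
def Lists (G : SimpleGraph V) (A : Set V) (R : Finset V) (L : V → Finset ℕ) (P : Set V) : Prop :=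
  ∀ v ∈ R, v ∉ P → 3 ≤ (L v).card ∧ (¬ Bd G A v → 5 ≤ (L v).card)

/-- `φ` is a proper colouring on `R`, from the lists outside `P`. -/
def Col (G : SimpleGraph V) (R : Finset V) (L : V → Finset ℕ) (P : Set V) (φ : V → ℕ) : Prop :=
  (∀ v ∈ R, v ∉ P → φ v ∈ L v) ∧ ∀ u ∈ R, ∀ v ∈ R, G.Adj u v → φ u ≠ φ v

open Classical in
/-- Remove the colours `C` from the lists of the inner neighbours of `w`. -/
noncomputable def cut (G : SimpleGraph V) (A : Set V) (L : V → Finset ℕ) (w : V) (C : Finset ℕ) :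
    V → Finset ℕ := fun v => if G.Adj w v ∧ ¬ Bd G A v then L v \ C else L v

section
open Classical

lemma del_base {A : Set V} {R : Finset V} (h : Base G A R) {w : V}
    (hb : Bd G A w ∨ A = ∅) : Base G (insert w A) (R.erase w) := by
  refine ⟨?_, ?_⟩
  · intro v hv hvA
    rcases hvA with rfl | hvA
    · simp at hv
    · exact h.1 v (Finset.mem_of_mem_erase hv) hvA
  · have key : ∀ a ∈ A, Conn G (insert w A) w a := by
      intro a ha
      rcases hb with ⟨b, hbA, hbw⟩ | rfl
      · exact (Conn.edge hbw.symm (by simp) (by simp [hbA])).trans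
          ((h.2 b hbA a ha).mono (Set.subset_insert _ _))
      · simp at ha
    rintro a (rfl | ha) b (rfl | hb')
    · exact Conn.refl (by simp)
    · exact key b hb'
    · exact (key a ha).symm
    · exact (h.2 a ha b hb').mono (Set.subset_insert _ _)

lemma del_lists {A : Set V} {R : Finset V} {L : V → Finset ℕ} {P P' : Set V} {w : V}
    {C : Finset ℕ} (hC : C.card ≤ 2) (h : Lists G A R L P) (hP : P ⊆ insert w P') :
    Lists G (insert w A) (R.erase w) (cut G A L w C) P' := by
  intro v hv hvP
  have hvw : v ≠ w := Finset.ne_of_mem_erase hv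
  have hvP' : v ∉ P := fun hh => by
    rcases hP hh with h | h
    · exact hvw h
    · exact hvP h
  obtain ⟨h3, h5⟩ := h v (Finset.mem_of_mem_erase hv) hvP'
  by_cases hc : G.Adj w v ∧ ¬ Bd G A v
  · simp only [cut, if_pos hc]
    have := h5 hc.2
    have h' := Finset.le_card_sdiff C (L v)
    refine ⟨by omega, fun hh => (hh ⟨w, by simp, hc.1⟩).elim⟩
  · simp only [cut, if_neg hc]
    refine ⟨h3, fun hh => h5 ?_⟩
    rintro ⟨a, ha, hav⟩
    exact hh ⟨a, by simp [ha], hav⟩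

lemma del_col {A : Set V} {R : Finset V} {L : V → Finset ℕ} {P P' : Set V} {w : V}
    {C : Finset ℕ} {φ : V → ℕ} (h : Col G (R.erase w) (cut G A L w C) P' φ)
    (hP : P' ⊆ P) (hb : ∀ v ∈ P', Bd G A v) {c : ℕ} (hcC : c ∈ C) (hcL : w ∉ P → c ∈ L w)
    (hP2 : P ⊆ insert w P')
    (hne : ∀ v ∈ R, Bd G A v → G.Adj w v → φ v ≠ c) :
    Col G R L P (Function.update φ w c) := by
  have hcut : ∀ v, cut G A L w C v ⊆ L v := by
    intro v
    unfold cut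
    split_ifs
    · exact Finset.sdiff_subset
    · exact subset_rfl
  have key : ∀ v ∈ R, G.Adj w v → φ v ≠ c := by
    intro v hv hwv
    by_cases hbv : Bd G A v
    · exact hne v hv hbv hwv
    · have := h.1 v (Finset.mem_erase.mpr ⟨hwv.ne', hv⟩) (fun hh => hbv (hb v hh))
      simp only [cut, if_pos (And.intro hwv hbv), Finset.mem_sdiff] at this
      rintro rfl
      exact this.2 hcC
  refine ⟨?_, ?_⟩
  · intro v hv hvP
    by_cases hvw : v = w
    · subst hvw; simpa using hcL hvP
    · rw [Function.update_of_ne hvw]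
      exact hcut v (h.1 v (Finset.mem_erase.mpr ⟨hvw, hv⟩) fun hh => hvP (hP hh))
  · intro u hu v hv huv
    by_cases huw : u = w
    · subst huw
      rw [Function.update_self, Function.update_of_ne huv.ne']
      exact (key v hv huv).symm
    · by_cases hvw : v = w
      · subst hvw
        rw [Function.update_self, Function.update_of_ne huw]
        exact key u hu huv.symm
      · rw [Function.update_of_ne huw, Function.update_of_ne hvw]
        exact h.2 u (Finset.mem_erase.mpr ⟨huw, hu⟩) v (Finset.mem_erase.mpr ⟨hvw, hv⟩) huv

/-- Colourability with an adjacent pair of precoloured vertices. -/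
def S2 (G : SimpleGraph V) (n : ℕ) : Prop :=
  ∀ (A : Set V) (R : Finset V) (L : V → Finset ℕ) (v₁ v₂ : V) (c₁ c₂ : ℕ), R.card = n →
    Base G A R → v₁ ∈ R → v₂ ∈ R → Bd G A v₁ → Bd G A v₂ → G.Adj v₁ v₂ → c₁ ≠ c₂ →
    Lists G A R L {v₁, v₂} → ∃ φ, φ v₁ = c₁ ∧ φ v₂ = c₂ ∧ Col G R L {v₁, v₂} φ

/-- Colourability with one precoloured vertex. -/
def S1 (G : SimpleGraph V) (n : ℕ) : Prop :=
  ∀ (A : Set V) (R : Finset V) (L : V → Finset ℕ) (v₁ : V) (c₁ : ℕ), R.card = n →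
    Base G A R → v₁ ∈ R → Bd G A v₁ →
    Lists G A R L {v₁} → ∃ φ, φ v₁ = c₁ ∧ Col G R L {v₁} φ

/-- Colourability without precoloured vertices. -/
def S0 (G : SimpleGraph V) (n : ℕ) : Prop :=
  ∀ (A : Set V) (R : Finset V) (L : V → Finset ℕ), R.card = n →
    Base G A R → Lists G A R L ∅ → ∃ φ, Col G R L ∅ φ

lemma step0 {n : ℕ} (h1 : S1 G n) (ih : ∀ m < n, S0 G m) : S0 G n := by
  intro A R L hn hB hL
  by_cases hX : ∃ v ∈ R, Bd G A v
  · obtain ⟨v, hv, hb⟩ := hX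
    obtain ⟨c, hc⟩ : (L v).Nonempty := by
      rw [← Finset.card_pos]; have := (hL v hv (by simp)).1; omega
    obtain ⟨φ, hφ, hcol⟩ := h1 A R L v c hn hB hv hb (fun u hu _ => hL u hu (by simp))
    refine ⟨φ, fun u hu _ => ?_, hcol.2⟩
    by_cases huv : u = v
    · subst huv; rw [hφ]; exact hc
    · exact hcol.1 u hu (by simpa using huv)
  · push Not at hX
    rcases R.eq_empty_or_nonempty with rfl | ⟨w, hw⟩
    · exact ⟨fun _ => 0, by simp [Col]⟩
    · obtain ⟨c, hc⟩ : (L w).Nonempty := by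
        rw [← Finset.card_pos]; have := (hL w hw (by simp)).1; omega
      have hB' : Base G ∅ R := ⟨by simp, by simp⟩
      have hL' : Lists G ∅ R L ∅ := fun v hv _ =>
        ⟨(hL v hv (by simp)).1, fun _ => (hL v hv (by simp)).2 (hX v hv)⟩
      obtain ⟨φ, hφ⟩ := ih (R.erase w).card
        (by rw [← hn]; exact Finset.card_erase_lt_of_mem hw) _ _ _ rfl
        (del_base hB' (w := w) (Or.inr rfl))
        (del_lists (C := {c}) (P' := ∅) (w := w) (by simp) hL' (by simp))
      refine ⟨_, del_col hφ (P := ∅) (by simp) (by simp) (c := c) (by simp) (fun _ => hc)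
        (by simp) ?_⟩
      rintro v - ⟨a, ha, -⟩
      simp at ha

lemma step1 {n : ℕ} (h2 : S2 G n) (ih : ∀ m < n, S0 G m) : S1 G n := by
  intro A R L v c hn hB hv hb hL
  by_cases hX : ∃ w ∈ R, Bd G A w ∧ G.Adj v w
  · obtain ⟨w, hw, hbw, hvw⟩ := hX
    obtain ⟨d, hd⟩ : (L w \ {c}).Nonempty := by
      rw [← Finset.card_pos]
      have := (hL w hw (by simpa using hvw.ne')).1
      have h' := Finset.le_card_sdiff {c} (L w)
      simp at h'
      omega
    simp only [Finset.mem_sdiff, Finset.mem_singleton] at hd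
    obtain ⟨φ, hφ, hφ', hcol⟩ := h2 A R L v w c d hn hB hv hw hb hbw hvw (Ne.symm hd.2)
      (fun u hu hu' => hL u hu (by simp at hu' ⊢; tauto))
    refine ⟨φ, hφ, fun u hu hu' => ?_, hcol.2⟩
    by_cases huw : u = w
    · subst huw; rw [hφ']; exact hd.1
    · exact hcol.1 u hu (by simp at hu' ⊢; tauto)
  · push Not at hX
    obtain ⟨φ, hφ⟩ := ih (R.erase v).card
        (by rw [← hn]; exact Finset.card_erase_lt_of_mem hv) _ _ _ rfl
        (del_base hB (w := v) (Or.inl hb))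
        (del_lists (C := {c}) (P' := ∅) (w := v) (by simp) hL (by simp))
    exact ⟨_, by simp, del_col hφ (P := {v}) (by simp) (by simp) (c := c) (by simp) (by simp)
        (by simp) fun u hu hbu hvu => (hX u hu hbu hvu).elim⟩

/-- Gluing colourings along the edge `ws`. -/
lemma glue {n : ℕ} (ih : ∀ m < n, S2 G m) {A : Set V} {R R₁ R₂ : Finset V} {L : V → Finset ℕ}
    {v₁ v₂ w s : V} {c₁ c₂ : ℕ} (hB : Base G A R) (h₁ : v₁ ∈ R₁) (h₂ : v₂ ∈ R₁)
    (b₁ : Bd G A v₁) (b₂ : Bd G A v₂) (adj : G.Adj v₁ v₂) (hne : c₁ ≠ c₂)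
    (hL : Lists G A R L {v₁, v₂}) (hU : ∀ v, v ∈ R ↔ v ∈ R₁ ∨ v ∈ R₂)
    (hI : ∀ v ∈ R₁, v ∈ R₂ → v = w ∨ v = s) (hw₁ : w ∈ R₁) (hw₂ : w ∈ R₂) (hs₁ : s ∈ R₁)
    (hs₂ : s ∈ R₂) (hws : G.Adj w s) (bw : Bd G A w) (bs : Bd G A s)
    (hc₁ : R₁.card < n) (hc₂ : R₂.card < n)
    (hE : ∀ u ∈ R₁, ∀ v ∈ R₂, G.Adj u v → u ∈ R₂ ∨ v ∈ R₁) :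
    ∃ φ, φ v₁ = c₁ ∧ φ v₂ = c₂ ∧ Col G R L {v₁, v₂} φ := by
  have hsub₁ : ∀ v ∈ R₁, v ∈ R := fun v hv => (hU v).mpr (Or.inl hv)
  have hsub₂ : ∀ v ∈ R₂, v ∈ R := fun v hv => (hU v).mpr (Or.inr hv)
  obtain ⟨φ, e₁, e₂, hφ⟩ := ih _ hc₁ A R₁ L v₁ v₂ c₁ c₂ rfl
    ⟨fun v hv => hB.1 v (hsub₁ v hv), hB.2⟩ h₁ h₂ b₁ b₂ adj hne
    (fun v hv hv' => hL v (hsub₁ v hv) hv')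
  have hnot : ∀ v ∈ R₂, v ∉ ({w, s} : Set V) → v ∉ R₁ := by
    intro v hv hv' hv1
    exact hv' (by simpa using hI v hv1 hv)
  obtain ⟨ψ, f₁, f₂, hψ⟩ := ih _ hc₂ A R₂ L w s (φ w) (φ s) rfl
    ⟨fun v hv => hB.1 v (hsub₂ v hv), hB.2⟩ hw₂ hs₂ bw bs hws (hφ.2 w hw₁ s hs₁ hws)
    (fun v hv hv' => hL v (hsub₂ v hv) (by
      have := hnot v hv hv'
      rintro (rfl | rfl)
      · exact this h₁
      · exact this h₂))
  have hagree : ∀ v ∈ R₁, v ∈ R₂ → φ v = ψ v := by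
    intro v hv hv'
    rcases hI v hv hv' with rfl | rfl
    · exact f₁.symm
    · exact f₂.symm
  have cross : ∀ u ∈ R₁, ∀ v ∈ R₂, v ∉ R₁ → G.Adj u v → φ u ≠ ψ v := by
    intro u hu v hv hv1 huv
    have hu2 := (hE u hu v hv huv).resolve_right hv1
    rw [hagree u hu hu2]
    exact hψ.2 u hu2 v hv huv
  refine ⟨fun v => if v ∈ R₁ then φ v else ψ v, by simp [h₁, e₁], by simp [h₂, e₂], ?_, ?_⟩
  · intro v hv hv'
    by_cases h : v ∈ R₁
    · simpa [h] using hφ.1 v h hv'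
    · have h2 := ((hU v).mp hv).resolve_left h
      simp only [h, if_false]
      refine hψ.1 v h2 ?_
      rintro (rfl | rfl) <;> contradiction
  · intro u hu v hv huv
    by_cases hu1 : u ∈ R₁ <;> by_cases hv1 : v ∈ R₁
    · simpa [hu1, hv1] using hφ.2 u hu1 v hv1 huv
    · simpa [hu1, hv1] using cross u hu1 v (((hU v).mp hv).resolve_left hv1) hv1 huv
    · simpa [hu1, hv1] using (cross v hv1 u (((hU u).mp hu).resolve_left hu1) hu1 huv.symm).symm
    · simpa [hu1, hv1] using hψ.2 u (((hU u).mp hu).resolve_left hu1) v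
        (((hU v).mp hv).resolve_left hv1) huv

/-- The separation case. -/
lemma sep {n : ℕ} (ih : ∀ m < n, S2 G m) {A : Set V} {R : Finset V} {L : V → Finset ℕ}
    {v₁ v₂ w s r t : V} {c₁ c₂ : ℕ} (hn : R.card = n) (hB : Base G A R) (h₁ : v₁ ∈ R) (h₂ : v₂ ∈ R)
    (b₁ : Bd G A v₁) (b₂ : Bd G A v₂) (adj : G.Adj v₁ v₂) (hne : c₁ ≠ c₂)
    (hL : Lists G A R L {v₁, v₂}) (hw : w ∈ R) (hs : s ∈ R) (hr : r ∈ R) (ht : t ∈ R)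
    (hws : G.Adj w s) (bw : Bd G A w) (bs : Bd G A s)
    (hrw : r ≠ w) (hrs : r ≠ s) (htw : t ≠ w) (hts : t ≠ s)
    (hsep : ¬ Conn G ((R : Set V) \ {w, s}) r t) :
    ∃ φ, φ v₁ = c₁ ∧ φ v₂ = c₂ ∧ Col G R L {v₁, v₂} φ := by
  set T : Set V := (R : Set V) \ {w, s} with hT
  have memT : ∀ v, v ∈ T ↔ v ∈ R ∧ v ≠ w ∧ v ≠ s := by
    intro v; simp [hT]
  -- the component of `r`
  let B : V → Prop := fun v => Conn G T r v
  have hBr : B r := Conn.refl ((memT r).mpr ⟨hr, hrw, hrs⟩)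
  have hBT : ∀ v, B v → v ∈ R ∧ v ≠ w ∧ v ≠ s := fun v hv => (memT v).mp hv.mem_right
  have hBadj : ∀ u v, B u → v ∈ R → G.Adj u v → B v ∨ v = w ∨ v = s := by
    intro u v hu hv huv
    by_cases hvw : v = w
    · exact Or.inr (Or.inl hvw)
    by_cases hvs : v = s
    · exact Or.inr (Or.inr hvs)
    exact Or.inl (hu.trans (Conn.edge huv hu.mem_right ((memT v).mpr ⟨hv, hvw, hvs⟩)))
  let R₁ : Finset V := R.filter fun v => B v ∨ v = w ∨ v = s
  let R₂ : Finset V := R.filter fun v => ¬ B v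
  have m₁ : ∀ v, v ∈ R₁ ↔ v ∈ R ∧ (B v ∨ v = w ∨ v = s) := fun v => by simp [R₁]
  have m₂ : ∀ v, v ∈ R₂ ↔ v ∈ R ∧ ¬ B v := fun v => by simp [R₂]
  have hBw : ¬ B w := fun h => (hBT w h).2.1 rfl
  have hBs : ¬ B s := fun h => (hBT s h).2.2 rfl
  have hc₁ : R₁.card < n := by
    rw [← hn]
    refine Finset.card_lt_card ⟨Finset.filter_subset _ _, fun hh => ?_⟩
    rcases ((m₁ t).mp (hh ht)).2 with h | h | h
    · exact hsep h
    · exact htw h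
    · exact hts h
  have hc₂ : R₂.card < n := by
    rw [← hn]
    refine Finset.card_lt_card ⟨Finset.filter_subset _ _, fun hh => ?_⟩
    exact ((m₂ r).mp (hh hr)).2 hBr
  by_cases hcase : B v₁ ∨ B v₂
  · have hv₁ : v₁ ∈ R₁ := by
      rw [m₁]
      refine ⟨h₁, ?_⟩
      rcases hcase with h | h
      · exact Or.inl h
      · exact hBadj v₂ v₁ h h₁ adj.symm
    have hv₂ : v₂ ∈ R₁ := by
      rw [m₁]
      refine ⟨h₂, ?_⟩
      rcases hcase with h | h
      · exact hBadj v₁ v₂ h h₂ adj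
      · exact Or.inl h
    refine glue ih (R₁ := R₁) (R₂ := R₂) (w := w) (s := s) hB hv₁ hv₂ b₁ b₂ adj hne hL
      ?_ ?_ ?_ ?_ ?_ ?_ hws bw bs hc₁ hc₂ ?_
    · intro v; rw [m₁, m₂]; tauto
    · intro v; rw [m₁, m₂]; tauto
    · rw [m₁]; tauto
    · rw [m₂]; tauto
    · rw [m₁]; tauto
    · rw [m₂]; tauto
    · intro u hu v hv huv
      rw [m₁] at hu
      rw [m₂] at hv
      rw [m₁, m₂]
      by_cases hBu : B u
      · exact Or.inr ⟨hv.1, hBadj u v hBu hv.1 huv⟩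
      · exact Or.inl ⟨hu.1, hBu⟩
  · push Not at hcase
    refine glue ih (R₁ := R₂) (R₂ := R₁) (w := w) (s := s) hB ((m₂ _).mpr ⟨h₁, hcase.1⟩)
      ((m₂ _).mpr ⟨h₂, hcase.2⟩) b₁ b₂ adj hne hL ?_ ?_ ?_ ?_ ?_ ?_ hws bw bs hc₂ hc₁ ?_
    · intro v; rw [m₁, m₂]; tauto
    · intro v; rw [m₁, m₂]; tauto
    · rw [m₂]; tauto
    · rw [m₁]; tauto
    · rw [m₂]; tauto
    · rw [m₁]; tauto
    · intro u hu v hv huv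
      rw [m₁] at hv
      rw [m₂] at hu
      rw [m₁, m₂]
      by_cases hBv : B v
      · exact Or.inl ⟨hu.1, hBadj v u hBv hu.1 huv.symm⟩
      · exact Or.inr ⟨hv.1, hBv⟩

lemma step2 (E : PlaneEmbedding G) {n : ℕ} (ih2 : ∀ m < n, S2 G m) (ih1 : ∀ m < n, S1 G m) :
    S2 G n := by
  intro A R L v₁ v₂ c₁ c₂ hn hB h₁ h₂ b₁ b₂ adj hne hL
  by_cases hX : ∃ w ∈ R, Bd G A w ∧ G.Adj v₁ w ∧ w ≠ v₂
  swap
  · -- delete `v₁`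
    push Not at hX
    obtain ⟨φ, hφ2, hφ⟩ := ih1 (R.erase v₁).card
        (by rw [← hn]; exact Finset.card_erase_lt_of_mem h₁) _ _ _ v₂ c₂ rfl
        (del_base hB (w := v₁) (Or.inl b₁))
        (Finset.mem_erase.mpr ⟨adj.ne', h₂⟩) ⟨v₁, by simp, adj⟩
        (del_lists (C := {c₁}) (P' := {v₂}) (w := v₁) (by simp) hL (by simp))
    refine ⟨_, ?_, ?_, del_col hφ (P := {v₁, v₂}) (by simp) (by simpa using b₂) (c := c₁)
      (by simp) (by simp) (by simp) ?_⟩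
    · simp
    · rw [Function.update_of_ne adj.ne', hφ2]
    · intro u hu hbu hvu
      rw [hX u hu hbu hvu, hφ2]
      exact hne.symm
  obtain ⟨w, hw, bw, hvw, hwv₂⟩ := hX
  have hwv₁ : w ≠ v₁ := hvw.ne'
  have h3 : 3 ≤ (L w).card := (hL w hw (by simp [hwv₁, hwv₂])).1
  -- deleting `w`
  have dele : ∀ C : Finset ℕ, C.card ≤ 2 → C ⊆ L w →
      (∀ φ : V → ℕ, φ v₁ = c₁ → φ v₂ = c₂ →
        ∃ c ∈ C, ∀ v ∈ R, Bd G A v → G.Adj w v → φ v ≠ c) →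
      ∃ φ, φ v₁ = c₁ ∧ φ v₂ = c₂ ∧ Col G R L {v₁, v₂} φ := by
    intro C hC hCL hchoose
    have up : ∀ v, Bd G A v → Bd G (insert w A) v := by
      rintro v ⟨a, ha, hav⟩
      exact ⟨a, by simp [ha], hav⟩
    obtain ⟨φ, e₁, e₂, hφ⟩ := ih2 (R.erase w).card
        (by rw [← hn]; exact Finset.card_erase_lt_of_mem hw) _ _ _ v₁ v₂ c₁ c₂ rfl
        (del_base hB (w := w) (Or.inl bw))
        (Finset.mem_erase.mpr ⟨hwv₁.symm, h₁⟩) (Finset.mem_erase.mpr ⟨hwv₂.symm, h₂⟩)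
        (up _ b₁) (up _ b₂) adj hne
        (del_lists (C := C) (P' := {v₁, v₂}) (w := w) hC hL (Set.subset_insert _ _))
    obtain ⟨c, hcC, hc⟩ := hchoose φ e₁ e₂
    refine ⟨_, ?_, ?_, del_col hφ (P := {v₁, v₂}) subset_rfl ?_ (c := c)
      hcC (fun _ => hCL hcC) (Set.subset_insert _ _) hc⟩
    · rw [Function.update_of_ne hwv₁.symm, e₁]
    · rw [Function.update_of_ne hwv₂.symm, e₂]
    · rintro v (rfl | rfl) <;> assumption
  by_cases hY : ∃ y, ∀ v ∈ R, Bd G A v → G.Adj w v → v = v₁ ∨ v = y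
  · obtain ⟨y, hy⟩ := hY
    by_cases hw2 : G.Adj w v₂
    · have hy2 : y = v₂ := ((hy v₂ h₂ b₂ hw2).resolve_left adj.ne').symm
      subst hy2
      obtain ⟨c, hc⟩ : (L w \ {c₁, c₂}).Nonempty := by
        rw [← Finset.card_pos]
        have h' := Finset.le_card_sdiff {c₁, c₂} (L w)
        have := Finset.card_le_two (a := c₁) (b := c₂)
        omega
      simp only [Finset.mem_sdiff, Finset.mem_insert, Finset.mem_singleton, not_or] at hc
      refine dele {c} (by simp) (by simpa using hc.1) fun φ e₁ e₂ => ⟨c, by simp, ?_⟩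
      intro v hv hbv hwv
      rcases hy v hv hbv hwv with rfl | rfl
      · rw [e₁]; exact Ne.symm hc.2.1
      · rw [e₂]; exact Ne.symm hc.2.2
    · obtain ⟨C, hCL, hC⟩ : ∃ C ⊆ L w \ {c₁}, C.card = 2 := by
        apply Finset.exists_subset_card_eq
        have h' := Finset.le_card_sdiff {c₁} (L w)
        simp at h'
        omega
      refine dele C hC.le (hCL.trans Finset.sdiff_subset) fun φ e₁ e₂ => ?_
      obtain ⟨c, hc⟩ : (C \ {φ y}).Nonempty := by
        rw [← Finset.card_pos]
        have h' := Finset.le_card_sdiff {φ y} C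
        simp at h'
        omega
      simp only [Finset.mem_sdiff, Finset.mem_singleton] at hc
      refine ⟨c, hc.1, fun v hv hbv hwv => ?_⟩
      rcases hy v hv hbv hwv with rfl | rfl
      · rw [e₁]
        have := hCL hc.1
        simp only [Finset.mem_sdiff, Finset.mem_singleton] at this
        exact Ne.symm this.2
      · exact Ne.symm hc.2
  · push Not at hY
    obtain ⟨y, hy, bdy, hwy, hyv, -⟩ := hY v₁
    obtain ⟨z, hz, bz, hwz, hzv, hzy⟩ := hY y
    by_cases cz : Conn G ((R : Set V) \ {w, z}) v₁ y
    swap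
    · exact sep ih2 hn hB h₁ h₂ b₁ b₂ adj hne hL hw hz h₁ hy hwz bw bz hwv₁.symm hzv.symm
        hwy.ne' hzy.symm cz
    by_cases cy : Conn G ((R : Set V) \ {w, y}) v₁ z
    swap
    · exact sep ih2 hn hB h₁ h₂ b₁ b₂ adj hne hL hw hy h₁ hz hwy bw bdy hwv₁.symm hyv.symm
        hwz.ne' hzy cy
    by_cases cx : Conn G ((R : Set V) \ {w, v₁}) y z
    swap
    · exact sep ih2 hn hB h₁ h₂ b₁ b₂ adj hne hL hw h₁ hy hz hvw.symm bw b₁ hwy.ne' hyv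
        hwz.ne' hzv cx
    exact (no_config E hB.2 (R := (R : Set V)) (fun v hv => hB.1 v hv) hw h₁ hy hz bw b₁ bdy bz
      hvw.symm hwy hwz hyv.symm hzv.symm hzy.symm cz cy cx).elim

lemma all_steps (E : PlaneEmbedding G) (n : ℕ) : S2 G n ∧ S1 G n ∧ S0 G n := by
  induction n using Nat.strong_induction_on with
  | _ n ih =>
    have a := step2 E (fun m hm => (ih m hm).1) (fun m hm => (ih m hm).2.1)
    have b := step1 a (fun m hm => (ih m hm).2.2)
    exact ⟨a, b, step0 b (fun m hm => (ih m hm).2.2)⟩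

end

end FiveChoose

/-- Every (finite, simple) planar graph is 5-choosable. -/
theorem planar_graphs_are_five_choosable {V : Type} [Fintype V] (G : SimpleGraph V)
    (hplanar : Nonempty (PlaneEmbedding G))
    (L : V → Finset ℕ) (hL : ∀ v : V, 5 ≤ (L v).card) :
    ∃ φ : V → ℕ, IsLColoring G L φ := by
  obtain ⟨E⟩ := hplanar
  obtain ⟨φ, hφ⟩ := (FiveChoose.all_steps E (Finset.univ : Finset V).card).2.2 ∅ Finset.univ L rfl
    ⟨by simp, by simp⟩ (fun v _ _ => ⟨by have := hL v; omega, fun _ => hL v⟩)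
  exact ⟨φ, fun v => hφ.1 v (by simp) (by simp), fun u w h => hφ.2 u (by simp) w (by simp) h⟩
end

section
/- Let G be a plane graph with outer cycle C, let P = p₁p₂ be a subpath of C of length one, and let L be a list-assignment for G such that |L(v)| ≥ 5 for all v ∈ V(G) \ V(C), |L(v)| ≥ 3 for all v ∈ V(C) \ V(P), |L(p₁)| = |L(p₂)| = 1, and L(p₁) ≠ L(p₂). Then G is L-colorable. -/
open Set Topology

/-- Continuous logarithm along a nonvanishing function on the plane of parameters. -/
theorem exists_clog {A : Type*} [TopologicalSpace A] [SimplyConnectedSpace A]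
    [LocallyPathConnectedSpace A] (f : A → ℂ) (hf : Continuous f) (h0 : ∀ a, f a ≠ 0) :
    ∃ g : A → ℂ, Continuous g ∧ ∀ a, Complex.exp (g a) = f a := by
  obtain ⟨a₀⟩ : Nonempty A := inferInstance
  obtain ⟨g, ⟨-, hg⟩, -⟩ := Complex.isCoveringMapOn_exp.existsUnique_continuousMap_lifts
    (f := ⟨f, hf⟩) (a₀ := a₀) (e₀ := Complex.log (f a₀)) (by simp [Complex.exp_log (h0 a₀)])
    (by intro a; simpa using h0 a)
  exact ⟨g, g.continuous, fun a => congrFun hg a⟩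

theorem clog_diff {A : Type*} [TopologicalSpace A] [PreconnectedSpace A] (g₁ g₂ : A → ℂ)
    (h₁ : Continuous g₁) (h₂ : Continuous g₂) (k : ℂ) (hk : k ≠ 0)
    (h : ∀ a, Complex.exp (g₁ a) = k * Complex.exp (g₂ a)) (a b : A) :
    g₁ b - g₁ a = g₂ b - g₂ a := by
  have hex : ∀ x, ∃ n : ℤ, g₁ x - g₂ x = Complex.log k + n * (2 * Real.pi * Complex.I) := by
    intro x
    apply Complex.exp_eq_exp_iff_exists_int.1
    rw [Complex.exp_sub, h x, Complex.exp_log hk]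
    field_simp [Complex.exp_ne_zero]
  choose n hn using hex
  have hpi : (2 * Real.pi * Complex.I : ℂ) ≠ 0 := Complex.two_pi_I_ne_zero
  have hc : Continuous n := by
    have : IsEmbedding (fun m : ℤ => (m : ℝ)) := Int.isClosedEmbedding_coe_real.isEmbedding
    rw [this.continuous_iff]
    have e : ((fun m : ℤ => (m : ℝ)) ∘ n) =
        fun x => ((g₁ x - g₂ x - Complex.log k) / (2 * Real.pi * Complex.I)).re := by
      funext x
      simp only [Function.comp]
      rw [hn x]
      rw [show (Complex.log k + (n x : ℂ) * (2 * Real.pi * Complex.I) - Complex.log k) /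
        (2 * Real.pi * Complex.I) = (n x : ℂ) by field_simp; ring]
      simp
    rw [e]
    fun_prop
  have := PreconnectedSpace.constant ‹_› hc (x := a) (y := b)
  have ha := hn a
  have hb := hn b
  rw [this] at ha
  linear_combination hb - ha

def IsCurve (f : ℝ → ℂ) (p q : ℂ) : Prop := Continuous f ∧ f 0 = p ∧ f 1 = q

def CurveDisj (f g : ℝ → ℂ) : Prop := ∀ s t, f s ≠ g t

open Classical in
/-- Increment of the logarithm of `f - z` along `f`. -/
noncomputable def logInc (z : ℂ) (f : ℝ → ℂ) : ℂ :=
  if h : ∃ g : ℝ → ℂ, Continuous g ∧ ∀ t, Complex.exp (g t) = f t - z then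
    h.choose 1 - h.choose 0 else 0

theorem logInc_eq {z : ℂ} {f : ℝ → ℂ} (g : ℝ → ℂ) (hg : Continuous g) (k : ℂ) (hk : k ≠ 0)
    (hf : Continuous f) (hz : ∀ t, f t ≠ z)
    (h : ∀ t, Complex.exp (g t) = k * (f t - z)) : logInc z f = g 1 - g 0 := by
  have hex : ∃ g : ℝ → ℂ, Continuous g ∧ ∀ t, Complex.exp (g t) = f t - z :=
    exists_clog _ (by fun_prop) (fun t => sub_ne_zero.2 (hz t))
  rw [logInc, dif_pos hex]
  refine (clog_diff g _ hg hex.choose_spec.1 k hk (fun a => ?_) 0 1).symm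
  rw [h, hex.choose_spec.2]

theorem logInc_int {z : ℂ} {f : ℝ → ℂ} (hf : Continuous f) (hz : ∀ t, f t ≠ z) (l₀ l₁ : ℂ)
    (h₀ : Complex.exp l₀ = f 0 - z) (h₁ : Complex.exp l₁ = f 1 - z) :
    ∃ n : ℤ, logInc z f = l₁ - l₀ + n * (2 * Real.pi * Complex.I) := by
  obtain ⟨g, hg, hgf⟩ := exists_clog (fun t => f t - z) (by fun_prop)
    (fun t => sub_ne_zero.2 (hz t))
  rw [logInc_eq g hg 1 one_ne_zero hf hz (by simpa using hgf)]
  apply Complex.exp_eq_exp_iff_exists_int.1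
  rw [Complex.exp_sub, Complex.exp_sub, hgf, hgf, h₀, h₁]

theorem logInc_pair {e f : ℝ → ℂ} {p q r s : ℂ} (he : IsCurve e p q) (hf : IsCurve f r s)
    (h : CurveDisj e f) :
    logInc q f - logInc p f = logInc s e - logInc r e := by
  obtain ⟨he, rfl, rfl⟩ := he
  obtain ⟨hf, rfl, rfl⟩ := hf
  obtain ⟨F, hF, hFe⟩ := exists_clog (fun x : ℝ × ℝ => f x.2 - e x.1) (by fun_prop)
    (fun x => sub_ne_zero.2 (h x.1 x.2).symm)
  have A : ∀ a, logInc (e a) f = F (a, 1) - F (a, 0) := fun a =>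
    logInc_eq (fun t => F (a, t)) (by fun_prop) 1 one_ne_zero hf (fun t => (h a t).symm)
      (by simpa using fun t => hFe (a, t))
  have B : ∀ a, logInc (f a) e = F (1, a) - F (0, a) := fun a =>
    logInc_eq (fun t => F (t, a)) (by fun_prop) (-1) (by simp) he (fun t => h t a)
      (by intro t; rw [hFe]; ring)
  rw [A, A, B, B]
  ring

theorem int_of_two_pi {m k : ℤ}
    (h : (m : ℂ) * (2 * Real.pi * Complex.I) = k * (2 * Real.pi * Complex.I)) : m = k := by
  exact_mod_cast mul_right_cancel₀ Complex.two_pi_I_ne_zero h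

theorem neg_log_aux {t x y : ℂ} (h : Complex.exp t = y - x) :
    Complex.exp (t + Real.pi * Complex.I) = x - y := by
  rw [Complex.exp_add, h, Complex.exp_pi_mul_I]; ring

/-- Van Kampen obstruction: every map of the complete graph on five vertices to the plane has two
independent edges whose images meet. -/
theorem no_k5 {x0 x1 x2 x3 x4 : ℂ} {e01 e02 e03 e04 e12 e13 e14 e23 e24 e34 : ℝ → ℂ}
    (c01 : IsCurve e01 x0 x1)
    (c02 : IsCurve e02 x0 x2)
    (c03 : IsCurve e03 x0 x3)
    (c04 : IsCurve e04 x0 x4)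
    (c12 : IsCurve e12 x1 x2)
    (c13 : IsCurve e13 x1 x3)
    (c14 : IsCurve e14 x1 x4)
    (c23 : IsCurve e23 x2 x3)
    (c24 : IsCurve e24 x2 x4)
    (c34 : IsCurve e34 x3 x4)
    (d0123 : CurveDisj e01 e23)
    (d0124 : CurveDisj e01 e24)
    (d0134 : CurveDisj e01 e34)
    (d0213 : CurveDisj e02 e13)
    (d0214 : CurveDisj e02 e14)
    (d0234 : CurveDisj e02 e34)
    (d0312 : CurveDisj e03 e12)
    (d0314 : CurveDisj e03 e14)
    (d0324 : CurveDisj e03 e24)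
    (d0412 : CurveDisj e04 e12)
    (d0413 : CurveDisj e04 e13)
    (d0423 : CurveDisj e04 e23)
    (d1234 : CurveDisj e12 e34)
    (d1324 : CurveDisj e13 e24)
    (d1423 : CurveDisj e14 e23) : False := by
  have l01 : Complex.exp (Complex.log (x1 - x0)) = x1 - x0 :=
    Complex.exp_log (sub_ne_zero.2 fun h => d0213 0 0 (by rw [c02.2.1, c13.2.1, h]))
  generalize Complex.log (x1 - x0) = t01 at l01
  have l10 := neg_log_aux l01
  have l02 : Complex.exp (Complex.log (x2 - x0)) = x2 - x0 :=
    Complex.exp_log (sub_ne_zero.2 fun h => d0123 0 0 (by rw [c01.2.1, c23.2.1, h]))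
  generalize Complex.log (x2 - x0) = t02 at l02
  have l20 := neg_log_aux l02
  have l03 : Complex.exp (Complex.log (x3 - x0)) = x3 - x0 :=
    Complex.exp_log (sub_ne_zero.2 fun h => d0123 0 1 (by rw [c01.2.1, c23.2.2, h]))
  generalize Complex.log (x3 - x0) = t03 at l03
  have l30 := neg_log_aux l03
  have l04 : Complex.exp (Complex.log (x4 - x0)) = x4 - x0 :=
    Complex.exp_log (sub_ne_zero.2 fun h => d0124 0 1 (by rw [c01.2.1, c24.2.2, h]))
  generalize Complex.log (x4 - x0) = t04 at l04
  have l40 := neg_log_aux l04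
  have l12 : Complex.exp (Complex.log (x2 - x1)) = x2 - x1 :=
    Complex.exp_log (sub_ne_zero.2 fun h => d0123 1 0 (by rw [c01.2.2, c23.2.1, h]))
  generalize Complex.log (x2 - x1) = t12 at l12
  have l21 := neg_log_aux l12
  have l13 : Complex.exp (Complex.log (x3 - x1)) = x3 - x1 :=
    Complex.exp_log (sub_ne_zero.2 fun h => d0123 1 1 (by rw [c01.2.2, c23.2.2, h]))
  generalize Complex.log (x3 - x1) = t13 at l13
  have l31 := neg_log_aux l13
  have l14 : Complex.exp (Complex.log (x4 - x1)) = x4 - x1 :=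
    Complex.exp_log (sub_ne_zero.2 fun h => d0124 1 1 (by rw [c01.2.2, c24.2.2, h]))
  generalize Complex.log (x4 - x1) = t14 at l14
  have l41 := neg_log_aux l14
  have l23 : Complex.exp (Complex.log (x3 - x2)) = x3 - x2 :=
    Complex.exp_log (sub_ne_zero.2 fun h => d0213 1 1 (by rw [c02.2.2, c13.2.2, h]))
  generalize Complex.log (x3 - x2) = t23 at l23
  have l32 := neg_log_aux l23
  have l24 : Complex.exp (Complex.log (x4 - x2)) = x4 - x2 :=
    Complex.exp_log (sub_ne_zero.2 fun h => d0214 1 1 (by rw [c02.2.2, c14.2.2, h]))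
  generalize Complex.log (x4 - x2) = t24 at l24
  have l42 := neg_log_aux l24
  have l34 : Complex.exp (Complex.log (x4 - x3)) = x4 - x3 :=
    Complex.exp_log (sub_ne_zero.2 fun h => d0314 1 1 (by rw [c03.2.2, c14.2.2, h]))
  generalize Complex.log (x4 - x3) = t34 at l34
  have l43 := neg_log_aux l34
  obtain ⟨n201, h201⟩ := logInc_int (z := x2) c01.1 (fun u hu => d0123 u 0 (by rw [hu, c23.2.1]))
    (t02 + Real.pi * Complex.I) (t12 + Real.pi * Complex.I) (by rw [l20, c01.2.1]) (by rw [l21, c01.2.2])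
  obtain ⟨n301, h301⟩ := logInc_int (z := x3) c01.1 (fun u hu => d0123 u 1 (by rw [hu, c23.2.2]))
    (t03 + Real.pi * Complex.I) (t13 + Real.pi * Complex.I) (by rw [l30, c01.2.1]) (by rw [l31, c01.2.2])
  obtain ⟨n401, h401⟩ := logInc_int (z := x4) c01.1 (fun u hu => d0124 u 1 (by rw [hu, c24.2.2]))
    (t04 + Real.pi * Complex.I) (t14 + Real.pi * Complex.I) (by rw [l40, c01.2.1]) (by rw [l41, c01.2.2])
  obtain ⟨n102, h102⟩ := logInc_int (z := x1) c02.1 (fun u hu => d0213 u 0 (by rw [hu, c13.2.1]))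
    (t01 + Real.pi * Complex.I) t12 (by rw [l10, c02.2.1]) (by rw [l12, c02.2.2])
  obtain ⟨n302, h302⟩ := logInc_int (z := x3) c02.1 (fun u hu => d0213 u 1 (by rw [hu, c13.2.2]))
    (t03 + Real.pi * Complex.I) (t23 + Real.pi * Complex.I) (by rw [l30, c02.2.1]) (by rw [l32, c02.2.2])
  obtain ⟨n402, h402⟩ := logInc_int (z := x4) c02.1 (fun u hu => d0214 u 1 (by rw [hu, c14.2.2]))
    (t04 + Real.pi * Complex.I) (t24 + Real.pi * Complex.I) (by rw [l40, c02.2.1]) (by rw [l42, c02.2.2])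
  obtain ⟨n103, h103⟩ := logInc_int (z := x1) c03.1 (fun u hu => d0312 u 0 (by rw [hu, c12.2.1]))
    (t01 + Real.pi * Complex.I) t13 (by rw [l10, c03.2.1]) (by rw [l13, c03.2.2])
  obtain ⟨n203, h203⟩ := logInc_int (z := x2) c03.1 (fun u hu => d0312 u 1 (by rw [hu, c12.2.2]))
    (t02 + Real.pi * Complex.I) t23 (by rw [l20, c03.2.1]) (by rw [l23, c03.2.2])
  obtain ⟨n403, h403⟩ := logInc_int (z := x4) c03.1 (fun u hu => d0314 u 1 (by rw [hu, c14.2.2]))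
    (t04 + Real.pi * Complex.I) (t34 + Real.pi * Complex.I) (by rw [l40, c03.2.1]) (by rw [l43, c03.2.2])
  obtain ⟨n104, h104⟩ := logInc_int (z := x1) c04.1 (fun u hu => d0412 u 0 (by rw [hu, c12.2.1]))
    (t01 + Real.pi * Complex.I) t14 (by rw [l10, c04.2.1]) (by rw [l14, c04.2.2])
  obtain ⟨n204, h204⟩ := logInc_int (z := x2) c04.1 (fun u hu => d0412 u 1 (by rw [hu, c12.2.2]))
    (t02 + Real.pi * Complex.I) t24 (by rw [l20, c04.2.1]) (by rw [l24, c04.2.2])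
  obtain ⟨n304, h304⟩ := logInc_int (z := x3) c04.1 (fun u hu => d0413 u 1 (by rw [hu, c13.2.2]))
    (t03 + Real.pi * Complex.I) t34 (by rw [l30, c04.2.1]) (by rw [l34, c04.2.2])
  obtain ⟨n012, h012⟩ := logInc_int (z := x0) c12.1 (fun u hu => d0312 0 u (by rw [hu, c03.2.1]))
    t01 t02 (by rw [l01, c12.2.1]) (by rw [l02, c12.2.2])
  obtain ⟨n312, h312⟩ := logInc_int (z := x3) c12.1 (fun u hu => d0312 1 u (by rw [hu, c03.2.2]))
    (t13 + Real.pi * Complex.I) (t23 + Real.pi * Complex.I) (by rw [l31, c12.2.1]) (by rw [l32, c12.2.2])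
  obtain ⟨n412, h412⟩ := logInc_int (z := x4) c12.1 (fun u hu => d0412 1 u (by rw [hu, c04.2.2]))
    (t14 + Real.pi * Complex.I) (t24 + Real.pi * Complex.I) (by rw [l41, c12.2.1]) (by rw [l42, c12.2.2])
  obtain ⟨n013, h013⟩ := logInc_int (z := x0) c13.1 (fun u hu => d0213 0 u (by rw [hu, c02.2.1]))
    t01 t03 (by rw [l01, c13.2.1]) (by rw [l03, c13.2.2])
  obtain ⟨n213, h213⟩ := logInc_int (z := x2) c13.1 (fun u hu => d0213 1 u (by rw [hu, c02.2.2]))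
    (t12 + Real.pi * Complex.I) t23 (by rw [l21, c13.2.1]) (by rw [l23, c13.2.2])
  obtain ⟨n413, h413⟩ := logInc_int (z := x4) c13.1 (fun u hu => d0413 1 u (by rw [hu, c04.2.2]))
    (t14 + Real.pi * Complex.I) (t34 + Real.pi * Complex.I) (by rw [l41, c13.2.1]) (by rw [l43, c13.2.2])
  obtain ⟨n014, h014⟩ := logInc_int (z := x0) c14.1 (fun u hu => d0214 0 u (by rw [hu, c02.2.1]))
    t01 t04 (by rw [l01, c14.2.1]) (by rw [l04, c14.2.2])
  obtain ⟨n214, h214⟩ := logInc_int (z := x2) c14.1 (fun u hu => d0214 1 u (by rw [hu, c02.2.2]))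
    (t12 + Real.pi * Complex.I) t24 (by rw [l21, c14.2.1]) (by rw [l24, c14.2.2])
  obtain ⟨n314, h314⟩ := logInc_int (z := x3) c14.1 (fun u hu => d0314 1 u (by rw [hu, c03.2.2]))
    (t13 + Real.pi * Complex.I) t34 (by rw [l31, c14.2.1]) (by rw [l34, c14.2.2])
  obtain ⟨n023, h023⟩ := logInc_int (z := x0) c23.1 (fun u hu => d0123 0 u (by rw [hu, c01.2.1]))
    t02 t03 (by rw [l02, c23.2.1]) (by rw [l03, c23.2.2])
  obtain ⟨n123, h123⟩ := logInc_int (z := x1) c23.1 (fun u hu => d0123 1 u (by rw [hu, c01.2.2]))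
    t12 t13 (by rw [l12, c23.2.1]) (by rw [l13, c23.2.2])
  obtain ⟨n423, h423⟩ := logInc_int (z := x4) c23.1 (fun u hu => d0423 1 u (by rw [hu, c04.2.2]))
    (t24 + Real.pi * Complex.I) (t34 + Real.pi * Complex.I) (by rw [l42, c23.2.1]) (by rw [l43, c23.2.2])
  obtain ⟨n024, h024⟩ := logInc_int (z := x0) c24.1 (fun u hu => d0124 0 u (by rw [hu, c01.2.1]))
    t02 t04 (by rw [l02, c24.2.1]) (by rw [l04, c24.2.2])
  obtain ⟨n124, h124⟩ := logInc_int (z := x1) c24.1 (fun u hu => d0124 1 u (by rw [hu, c01.2.2]))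
    t12 t14 (by rw [l12, c24.2.1]) (by rw [l14, c24.2.2])
  obtain ⟨n324, h324⟩ := logInc_int (z := x3) c24.1 (fun u hu => d0324 1 u (by rw [hu, c03.2.2]))
    (t23 + Real.pi * Complex.I) t34 (by rw [l32, c24.2.1]) (by rw [l34, c24.2.2])
  obtain ⟨n034, h034⟩ := logInc_int (z := x0) c34.1 (fun u hu => d0134 0 u (by rw [hu, c01.2.1]))
    t03 t04 (by rw [l03, c34.2.1]) (by rw [l04, c34.2.2])
  obtain ⟨n134, h134⟩ := logInc_int (z := x1) c34.1 (fun u hu => d0134 1 u (by rw [hu, c01.2.2]))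
    t13 t14 (by rw [l13, c34.2.1]) (by rw [l14, c34.2.2])
  obtain ⟨n234, h234⟩ := logInc_int (z := x2) c34.1 (fun u hu => d0234 1 u (by rw [hu, c02.2.2]))
    t23 t24 (by rw [l23, c34.2.1]) (by rw [l24, c34.2.2])
  have k0123 : n123 - n023 - n301 + n201 = 0 := by
    apply int_of_two_pi
    have := logInc_pair c01 c23 d0123
    rw [h123, h023, h301, h201] at this
    push_cast
    linear_combination this
  have k0124 : n124 - n024 - n401 + n201 = 0 := by
    apply int_of_two_pi
    have := logInc_pair c01 c24 d0124
    rw [h124, h024, h401, h201] at this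
    push_cast
    linear_combination this
  have k0134 : n134 - n034 - n401 + n301 = 0 := by
    apply int_of_two_pi
    have := logInc_pair c01 c34 d0134
    rw [h134, h034, h401, h301] at this
    push_cast
    linear_combination this
  have k0213 : n213 - n013 - n302 + n102 = 1 := by
    apply int_of_two_pi
    have := logInc_pair c02 c13 d0213
    rw [h213, h013, h302, h102] at this
    push_cast
    linear_combination this
  have k0214 : n214 - n014 - n402 + n102 = 1 := by
    apply int_of_two_pi
    have := logInc_pair c02 c14 d0214
    rw [h214, h014, h402, h102] at this
    push_cast
    linear_combination this
  have k0234 : n234 - n034 - n402 + n302 = 0 := by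
    apply int_of_two_pi
    have := logInc_pair c02 c34 d0234
    rw [h234, h034, h402, h302] at this
    push_cast
    linear_combination this
  have k0312 : n312 - n012 - n203 + n103 = 0 := by
    apply int_of_two_pi
    have := logInc_pair c03 c12 d0312
    rw [h312, h012, h203, h103] at this
    push_cast
    linear_combination this
  have k0314 : n314 - n014 - n403 + n103 = 1 := by
    apply int_of_two_pi
    have := logInc_pair c03 c14 d0314
    rw [h314, h014, h403, h103] at this
    push_cast
    linear_combination this
  have k0324 : n324 - n024 - n403 + n203 = 1 := by
    apply int_of_two_pi
    have := logInc_pair c03 c24 d0324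
    rw [h324, h024, h403, h203] at this
    push_cast
    linear_combination this
  have k0412 : n412 - n012 - n204 + n104 = 0 := by
    apply int_of_two_pi
    have := logInc_pair c04 c12 d0412
    rw [h412, h012, h204, h104] at this
    push_cast
    linear_combination this
  have k0413 : n413 - n013 - n304 + n104 = 0 := by
    apply int_of_two_pi
    have := logInc_pair c04 c13 d0413
    rw [h413, h013, h304, h104] at this
    push_cast
    linear_combination this
  have k0423 : n423 - n023 - n304 + n204 = 0 := by
    apply int_of_two_pi
    have := logInc_pair c04 c23 d0423
    rw [h423, h023, h304, h204] at this
    push_cast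
    linear_combination this
  have k1234 : n234 - n134 - n412 + n312 = 0 := by
    apply int_of_two_pi
    have := logInc_pair c12 c34 d1234
    rw [h234, h134, h412, h312] at this
    push_cast
    linear_combination this
  have k1324 : n324 - n124 - n413 + n213 = 1 := by
    apply int_of_two_pi
    have := logInc_pair c13 c24 d1324
    rw [h324, h124, h413, h213] at this
    push_cast
    linear_combination this
  have k1423 : n423 - n123 - n314 + n214 = 0 := by
    apply int_of_two_pi
    have := logInc_pair c14 c23 d1423
    rw [h423, h123, h314, h214] at this
    push_cast
    linear_combination this
  omega

section Combinatorial

/-- `G[S]` is `L`-colorable. -/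
def ColOn {V : Type*} (G : SimpleGraph V) (S : Finset V) (L : V → Finset ℕ) : Prop :=
  ∃ φ : V → ℕ, (∀ v ∈ S, φ v ∈ L v) ∧ ∀ u ∈ S, ∀ w ∈ S, G.Adj u w → φ u ≠ φ w

/-- `b` can be reached from `a` by a walk all of whose later vertices lie in `T`. -/
def ConnIn {V : Type*} (G : SimpleGraph V) (T : Finset V) (a b : V) : Prop :=
  Relation.ReflTransGen (fun u w => G.Adj u w ∧ w ∈ T) a b

open Classical in
/-- The properties of `P S O` ("`G[S]` is drawn in the plane and all vertices of `O` are incident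
with one common face") that are used in the coloring argument. -/
structure PlaneLike {V : Type*} (G : SimpleGraph V) (P : Finset V → Finset V → Prop) : Prop where
  sub : ∀ S O, P S O → O ⊆ S
  mono : ∀ S O S', P S O → S' ⊆ S → P S' (O ∩ S')
  del : ∀ S O v, P S O → v ∈ O → P (S.erase v) ((O ∪ S.filter (G.Adj v)).erase v)
  del' : ∀ S O v, P S O → v ∈ S → P (S.erase v) (S.filter (G.Adj v))
  noK5 : ∀ S O v a b c, P S O → v ∈ O → a ∈ O → b ∈ O → c ∈ O → a ≠ b → b ≠ c → a ≠ c →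
    G.Adj v a → G.Adj v b → G.Adj v c →
    ConnIn G (S \ {v, c}) a b → ConnIn G (S \ {v, a}) b c → ConnIn G (S \ {v, b}) a c → False

variable {V : Type*} {G : SimpleGraph V}

theorem ColOn.mono {S : Finset V} {L L' : V → Finset ℕ} (h : ColOn G S L')
    (hL : ∀ v ∈ S, L' v ⊆ L v) : ColOn G S L := by
  obtain ⟨φ, h1, h2⟩ := h
  exact ⟨φ, fun v hv => hL v hv (h1 v hv), h2⟩

open Classical in
/-- Color `v` by one of the colors in `D`, after removing `D` from the lists of its neighbors
outside of `X`. -/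
theorem ColOn.extend {S X : Finset V} {L : V → Finset ℕ} {v : V} {D : Finset ℕ}
    (hD : D ⊆ L v)
    (h : ColOn G (S.erase v) (fun w => if G.Adj v w ∧ w ∉ X then L w \ D else L w))
    (hX : ∀ φ : V → ℕ, (∀ w ∈ S.erase v, φ w ∈ L w) →
      ∃ d ∈ D, ∀ w ∈ S, w ∈ X → G.Adj v w → φ w ≠ d) : ColOn G S L := by
  obtain ⟨φ, h1, h2⟩ := h
  obtain ⟨d, hd, hdX⟩ := hX φ (by
    intro w hw
    have := h1 w hw
    dsimp only at this
    split_ifs at this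
    · exact (Finset.mem_sdiff.1 this).1
    · exact this)
  have key : ∀ w ∈ S, G.Adj v w → φ w ≠ d := by
    intro w hw hvw
    by_cases hwX : w ∈ X
    · exact hdX w hw hwX hvw
    · have := h1 w (Finset.mem_erase.2 ⟨hvw.ne', hw⟩)
      dsimp only at this
      rw [if_pos ⟨hvw, hwX⟩] at this
      rintro rfl
      exact (Finset.mem_sdiff.1 this).2 hd
  refine ⟨fun w => if w = v then d else φ w, ?_, ?_⟩
  · intro w hw
    by_cases hwv : w = v
    · subst hwv; simpa using hD hd
    · have := h1 w (Finset.mem_erase.2 ⟨hwv, hw⟩)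
      dsimp only at this
      simp only [hwv, if_false]
      split_ifs at this
      · exact (Finset.mem_sdiff.1 this).1
      · exact this
  · intro u hu w hw huw
    by_cases huv : u = v
    · subst huv
      simpa [huw.ne'] using (key w hw huw).symm
    · by_cases hwv : w = v
      · subst hwv
        simpa [huv] using key u hu huw.symm
      · simpa [huv, hwv] using
          h2 u (Finset.mem_erase.2 ⟨huv, hu⟩) w (Finset.mem_erase.2 ⟨hwv, hw⟩) huw

def StTwo (G : SimpleGraph V) (P : Finset V → Finset V → Prop) (n : ℕ) : Prop :=
  ∀ S O : Finset V, S.card = n → P S O → ∀ (L : V → Finset ℕ) (p₁ p₂ : V) (c₁ c₂ : ℕ),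
    p₁ ∈ O → p₂ ∈ O → G.Adj p₁ p₂ → L p₁ = {c₁} → L p₂ = {c₂} → c₁ ≠ c₂ →
    (∀ v ∈ S, v ∉ O → 5 ≤ (L v).card) → (∀ v ∈ O, v ≠ p₁ → v ≠ p₂ → 3 ≤ (L v).card) → ColOn G S L

def StOne (G : SimpleGraph V) (P : Finset V → Finset V → Prop) (n : ℕ) : Prop :=
  ∀ S O : Finset V, S.card = n → P S O → ∀ (L : V → Finset ℕ) (p : V),
    p ∈ O → (L p).Nonempty →
    (∀ v ∈ S, v ∉ O → 5 ≤ (L v).card) → (∀ v ∈ O, v ≠ p → 3 ≤ (L v).card) → ColOn G S L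

def StZero (G : SimpleGraph V) (P : Finset V → Finset V → Prop) (n : ℕ) : Prop :=
  ∀ S O : Finset V, S.card = n → P S O → ∀ (L : V → Finset ℕ),
    (∀ v ∈ S, v ∉ O → 5 ≤ (L v).card) → (∀ v ∈ O, 3 ≤ (L v).card) → ColOn G S L

theorem card_sdiff_le' (A B : Finset ℕ) (k m : ℕ) (hA : k + m ≤ A.card) (hB : B.card ≤ m) :
    k ≤ (A \ B).card := by
  have := Finset.le_card_sdiff B A
  omega

open Classical in
theorem stOne_of {P : Finset V → Finset V → Prop} (hP : PlaneLike G P) (n : ℕ)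
    (h2 : StTwo G P n) (h0 : ∀ m < n, StZero G P m) : StOne G P n := by
  intro S O hS hPS L p hp hLp h5 h3
  obtain ⟨c, hc⟩ := hLp
  have hpS := hP.sub _ _ hPS hp
  by_cases hq : ∃ q ∈ O, G.Adj p q
  · obtain ⟨q, hq, hpq⟩ := hq
    have h3q := h3 q hq hpq.ne'
    obtain ⟨c', hc'⟩ : (L q \ {c}).Nonempty := by
      rw [← Finset.card_pos]
      exact card_sdiff_le' _ _ 1 1 (by omega) (by simp)
    rw [Finset.mem_sdiff, Finset.mem_singleton] at hc'
    refine ColOn.mono (L' := fun w => if w = p then {c} else if w = q then {c'} else L w)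
      (h2 S O hS hPS _ p q c c' hp hq hpq (by simp) (by simp [hpq.ne']) (Ne.symm hc'.2) ?_ ?_) ?_
    · intro v hv hvO
      have h1 : v ≠ p := by rintro rfl; exact hvO hp
      have h2 : v ≠ q := by rintro rfl; exact hvO hq
      simpa [h1, h2] using h5 v hv hvO
    · intro v hv h1 h2
      simpa [h1, h2] using h3 v hv h1
    · intro v hv
      split_ifs with h1 h2
      · subst h1; simpa using hc
      · subst h2; simpa using hc'.1
      · exact subset_rfl
  · push Not at hq
    refine ColOn.extend (X := ∅) (D := {c}) (v := p) (by simpa using hc) ?_ (by simp)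
    refine h0 (S.erase p).card (by rw [← hS]; exact Finset.card_erase_lt_of_mem hpS) _ _ rfl
      (hP.del S O p hPS hp) _ ?_ ?_
    · intro v hv hvO
      simp only [Finset.mem_erase, Finset.mem_union, Finset.mem_filter] at hv hvO
      have : ¬ G.Adj p v := by tauto
      simp only [this, false_and, if_false]
      exact h5 v hv.2 (by tauto)
    · intro v hv
      simp only [Finset.mem_erase, Finset.mem_union, Finset.mem_filter] at hv
      split_ifs with hvp
      · have hvO : v ∉ O := fun h => hq v h hvp.1
        exact card_sdiff_le' _ _ 3 1 (by have := h5 v (by tauto) hvO; omega) (by simp)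
      · by_cases hvO : v ∈ O
        · exact h3 v hvO hv.1
        · have := h5 v (by tauto) hvO; omega

open Classical in
theorem stZero_of {P : Finset V → Finset V → Prop} (hP : PlaneLike G P) (n : ℕ)
    (h1 : StOne G P n) (h0 : ∀ m < n, StZero G P m) : StZero G P n := by
  intro S O hS hPS L h5 h3
  rcases O.eq_empty_or_nonempty with rfl | ⟨p, hp⟩
  · rcases S.eq_empty_or_nonempty with rfl | ⟨v, hv⟩
    · exact ⟨fun _ => 0, by simp, by simp⟩
    · have h5' : ∀ v ∈ S, 5 ≤ (L v).card := fun v hv => h5 v hv (by simp)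
      obtain ⟨c, hc⟩ : (L v).Nonempty := by
        rw [← Finset.card_pos]; have := h5' v hv; omega
      refine ColOn.extend (X := ∅) (D := {c}) (v := v) (by simpa using hc) ?_ (by simp)
      refine h0 (S.erase v).card (by rw [← hS]; exact Finset.card_erase_lt_of_mem hv) _ _ rfl
        (hP.del' S _ v hPS hv) _ ?_ ?_
      · intro w hw hwO
        simp only [Finset.mem_erase, Finset.mem_filter] at hw hwO
        have : ¬ G.Adj v w := by tauto
        simp only [this, false_and, if_false]
        exact h5' w hw.2
      · intro w hw
        simp only [Finset.mem_filter] at hw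
        have := h5' w hw.1
        split_ifs
        · exact card_sdiff_le' _ _ 3 1 (by omega) (by simp)
        · omega
  · exact h1 S O hS hPS L p hp (by rw [← Finset.card_pos]; have := h3 p hp; omega) h5
      (fun v hv _ => h3 v hv)

open Classical in
/-- Splitting along a separation `A, {x, y}, B` with `x, y` adjacent. -/
theorem split_of {P : Finset V → Finset V → Prop} (hP : PlaneLike G P) (n : ℕ)
    (h2 : ∀ m < n, StTwo G P m) (S O : Finset V) (hS : S.card = n) (hPS : P S O)
    (L : V → Finset ℕ) (p₁ p₂ : V) (c₁ c₂ : ℕ)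
    (hp₁ : p₁ ∈ O) (hp₂ : p₂ ∈ O) (hp : G.Adj p₁ p₂) (hL₁ : L p₁ = {c₁}) (hL₂ : L p₂ = {c₂})
    (hc : c₁ ≠ c₂) (h5 : ∀ v ∈ S, v ∉ O → 5 ≤ (L v).card)
    (h3 : ∀ v ∈ O, v ≠ p₁ → v ≠ p₂ → 3 ≤ (L v).card)
    (x y : V) (hx : x ∈ O) (hy : y ∈ O) (hxy : G.Adj x y) (A B : Finset V)
    (hA : A.Nonempty) (hB : B.Nonempty)
    (hAB : ∀ v, v ∈ S ↔ v ∈ A ∨ v ∈ B ∨ v = x ∨ v = y) (hdis : ∀ v ∈ A, v ∉ B)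
    (hxA : x ∉ A) (hxB : x ∉ B) (hyA : y ∉ A) (hyB : y ∉ B)
    (hno : ∀ a ∈ A, ∀ b ∈ B, ¬ G.Adj a b) (hq₁ : p₁ ∉ B) (hq₂ : p₂ ∉ B) : ColOn G S L := by
  have hsub := hP.sub _ _ hPS
  have hcol1 : ColOn G (S \ B) L := by
    have hlt : (S \ B).card < n := by
      rw [← hS]
      apply Finset.card_lt_card
      rw [Finset.ssubset_iff_of_subset Finset.sdiff_subset]
      obtain ⟨b, hb⟩ := hB
      exact ⟨b, (hAB b).2 (by tauto), by simp [hb]⟩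
    refine h2 _ hlt (S \ B) _ rfl (hP.mono S O _ hPS Finset.sdiff_subset) L p₁ p₂ c₁ c₂
      ?_ ?_ hp hL₁ hL₂ hc ?_ ?_
    · simp [hp₁, hq₁, hsub hp₁]
    · simp [hp₂, hq₂, hsub hp₂]
    · intro v hv hvO
      simp only [Finset.mem_sdiff, Finset.mem_inter] at hv hvO
      exact h5 v hv.1 (by tauto)
    · intro v hv
      exact h3 v (Finset.mem_inter.1 hv).1
  obtain ⟨φ, hφ1, hφ2⟩ := hcol1
  have hxm : x ∈ S \ B := by simp [hsub hx, hxB]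
  have hym : y ∈ S \ B := by simp [hsub hy, hyB]
  have hcol2 : ColOn G (S \ A)
      (fun w => if w = x then {φ x} else if w = y then {φ y} else L w) := by
    have hlt : (S \ A).card < n := by
      rw [← hS]
      apply Finset.card_lt_card
      rw [Finset.ssubset_iff_of_subset Finset.sdiff_subset]
      obtain ⟨b, hb⟩ := hA
      exact ⟨b, (hAB b).2 (by tauto), by simp [hb]⟩
    refine h2 _ hlt (S \ A) _ rfl (hP.mono S O _ hPS Finset.sdiff_subset) _ x y (φ x) (φ y)
      ?_ ?_ hxy (by simp) (by simp [hxy.ne']) (hφ2 x hxm y hym hxy) ?_ ?_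
    · simp [hx, hxA, hsub hx]
    · simp [hy, hyA, hsub hy]
    · intro v hv hvO
      simp only [Finset.mem_sdiff, Finset.mem_inter] at hv hvO
      have hvO' : v ∉ O := by tauto
      have h1 : v ≠ x := by rintro rfl; exact hvO' hx
      have h2 : v ≠ y := by rintro rfl; exact hvO' hy
      simpa [h1, h2] using h5 v hv.1 hvO'
    · intro v hv h1 h2
      simp only [Finset.mem_sdiff, Finset.mem_inter] at hv
      have hvB : v ∈ B := by have := (hAB v).1 hv.2.1; tauto
      simpa [h1, h2] using h3 v hv.1 (by rintro rfl; exact hq₁ hvB) (by rintro rfl; exact hq₂ hvB)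
  obtain ⟨ψ, hψ1, hψ2⟩ := hcol2
  have hψx : ψ x = φ x := by simpa using hψ1 x (by simp [hsub hx, hxA])
  have hψy : ψ y = φ y := by simpa [hxy.ne'] using hψ1 y (by simp [hsub hy, hyA])
  have agree : ∀ v ∈ S, v ∉ B → v ∉ A → ψ v = φ v := by
    intro v hv hvB hvA
    rcases (hAB v).1 hv with h | h | rfl | rfl
    · exact absurd h hvA
    · exact absurd h hvB
    · exact hψx
    · exact hψy
  refine ⟨fun v => if v ∈ B then ψ v else φ v, ?_, ?_⟩
  · intro v hv
    dsimp only
    split_ifs with h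
    · have := hψ1 v (by simp only [Finset.mem_sdiff]; exact ⟨hv, fun h' => hdis v h' h⟩)
      have h1 : v ≠ x := by rintro rfl; exact hxB h
      have h2 : v ≠ y := by rintro rfl; exact hyB h
      simpa [h1, h2] using this
    · exact hφ1 v (by simp [hv, h])
  · intro u hu w hw huw
    dsimp only
    by_cases huB : u ∈ B
    · have huA : u ∉ A := fun h => hdis u h huB
      have hwA : w ∉ A := fun h => hno w h u huB huw.symm
      have := hψ2 u (by simp [hu, huA]) w (by simp [hw, hwA]) huw
      by_cases hwB : w ∈ B
      · simpa [huB, hwB] using this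
      · simpa [huB, hwB, ← agree w hw hwB hwA] using this
    · by_cases hwB : w ∈ B
      · have hwA : w ∉ A := fun h => hdis w h hwB
        have huA : u ∉ A := fun h => hno u h w hwB huw
        have := hψ2 u (by simp [hu, huA]) w (by simp [hw, hwA]) huw
        simpa [huB, hwB, ← agree u hu huB huA] using this
      · simpa [huB, hwB] using hφ2 u (by simp [hu, huB]) w (by simp [hw, hwB]) huw

set_option maxHeartbeats 1000000 in
open Classical in
theorem stTwo_of {P : Finset V → Finset V → Prop} (hP : PlaneLike G P) (n : ℕ)
    (h2 : ∀ m < n, StTwo G P m) (h1 : ∀ m < n, StOne G P m) : StTwo G P n := by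
  intro S O hS hPS L p₁ p₂ c₁ c₂ hp₁ hp₂ hp hL₁ hL₂ hc h5 h3
  have hsub := hP.sub _ _ hPS
  -- Case A
  by_cases hA : ∃ v ∈ O, v ≠ p₁ ∧ v ≠ p₂ ∧ ∃ u, ∀ w ∈ O, G.Adj v w → w = p₁ ∨ w = u
  · obtain ⟨v, hv, hv1, hv2, u, hu⟩ := hA
    have hcard : 2 ≤ (L v \ {c₁}).card :=
      card_sdiff_le' _ _ 2 1 (h3 v hv hv1 hv2) (by simp)
    obtain ⟨D, hDs, hDc⟩ := Finset.exists_subset_card_eq hcard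
    have hDL : D ⊆ L v := hDs.trans Finset.sdiff_subset
    have hDc1 : c₁ ∉ D := fun h => by simpa using hDs h
    refine ColOn.extend (X := O) (D := D) (v := v) hDL ?_ ?_
    · have hlt : (S.erase v).card < n := by
        rw [← hS]; exact Finset.card_erase_lt_of_mem (hsub hv)
      refine h2 _ hlt _ _ rfl (hP.del S O v hPS hv) _ p₁ p₂ c₁ c₂ ?_ ?_ hp
        (by simp [hp₁, hL₁]) (by simp [hp₂, hL₂]) hc ?_ ?_
      · simp [hv1.symm, hp₁]
      · simp [hv2.symm, hp₂]
      · intro w hw hwO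
        simp only [Finset.mem_erase, Finset.mem_union, Finset.mem_filter] at hw hwO
        have : ¬ G.Adj v w := by tauto
        simp only [this, false_and, if_false]
        exact h5 w hw.2 (by tauto)
      · intro w hw hw1 hw2
        simp only [Finset.mem_erase, Finset.mem_union, Finset.mem_filter] at hw
        split_ifs with hvw
        · exact card_sdiff_le' _ _ 3 2 (h5 w (by tauto) hvw.2) hDc.le
        · by_cases hwO : w ∈ O
          · exact h3 w hwO hw1 hw2
          · have := h5 w (by tauto) hwO; omega
    · intro φ hφ
      obtain ⟨d, hd, hdu⟩ : ∃ d ∈ D, d ≠ φ u :=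
        Finset.exists_mem_ne (by omega) (φ u)
      refine ⟨d, hd, ?_⟩
      intro w hw hwO hvw
      rcases hu w hwO hvw with rfl | rfl
      · have := hφ w (by simp [hvw.ne', hw])
        rw [hL₁, Finset.mem_singleton] at this
        rw [this]; rintro rfl; exact hDc1 hd
      · exact hdu.symm
  -- Case B
  by_cases hB : ∃ x ∈ O, ∃ y ∈ O, G.Adj x y ∧ ∃ a ∈ S \ {x, y}, ∃ b ∈ S \ {x, y},
      ¬ ConnIn G (S \ {x, y}) a b
  · obtain ⟨x, hx, y, hy, hxy, a, ha, b, hb, hab⟩ := hB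
    set T := S \ {x, y} with hT
    have hmemT : ∀ v, v ∈ T ↔ v ∈ S ∧ v ≠ x ∧ v ≠ y := by
      intro v; simp [hT]
    set A := T.filter (fun v => ConnIn G T a v) with hAdef
    set B := T.filter (fun v => ¬ ConnIn G T a v) with hBdef
    have hmA : ∀ v, v ∈ A ↔ v ∈ T ∧ ConnIn G T a v := fun v => by simp [hAdef]
    have hmB : ∀ v, v ∈ B ↔ v ∈ T ∧ ¬ ConnIn G T a v := fun v => by simp [hBdef]
    have hAne : A.Nonempty := ⟨a, (hmA a).2 ⟨ha, Relation.ReflTransGen.refl⟩⟩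
    have hBne : B.Nonempty := ⟨b, (hmB b).2 ⟨hb, hab⟩⟩
    have hno : ∀ a ∈ A, ∀ b ∈ B, ¬ G.Adj a b := by
      intro u hu w hw huw
      exact ((hmB w).1 hw).2 (((hmA u).1 hu).2.tail ⟨huw, ((hmB w).1 hw).1⟩)
    have hcov : ∀ v, v ∈ S ↔ v ∈ A ∨ v ∈ B ∨ v = x ∨ v = y := by
      intro v
      rw [hmA, hmB, hmemT]
      have := hsub hx
      have := hsub hy
      constructor
      · tauto
      · rintro (h | h | rfl | rfl) <;> tauto
    have hdis : ∀ v ∈ A, v ∉ B := by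
      intro v; rw [hmA, hmB]; tauto
    have hxA : x ∉ A := by rw [hmA, hmemT]; tauto
    have hxB : x ∉ B := by rw [hmB, hmemT]; tauto
    have hyA : y ∉ A := by rw [hmA, hmemT]; tauto
    have hyB : y ∉ B := by rw [hmB, hmemT]; tauto
    by_cases hq : p₁ ∉ B ∧ p₂ ∉ B
    · exact split_of hP n h2 S O hS hPS L p₁ p₂ c₁ c₂ hp₁ hp₂ hp hL₁ hL₂ hc h5 h3 x y hx hy hxy
        A B hAne hBne hcov hdis hxA hxB hyA hyB hno hq.1 hq.2
    · have hq' : p₁ ∉ A ∧ p₂ ∉ A := by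
        have h1 := hno p₁
        have h2 := hno p₂
        have h3 := hdis p₁
        have h4 := hdis p₂
        have h6 := hp.symm
        constructor
        · intro h
          by_cases h7 : p₂ ∈ B
          · exact h1 h p₂ h7 hp
          · exact hq ⟨h3 h, h7⟩
        · intro h
          by_cases h7 : p₁ ∈ B
          · exact h2 h p₁ h7 h6
          · exact hq ⟨h7, h4 h⟩
      exact split_of hP n h2 S O hS hPS L p₁ p₂ c₁ c₂ hp₁ hp₂ hp hL₁ hL₂ hc h5 h3 x y hx hy hxy
        B A hBne hAne (fun v => (hcov v).trans or_left_comm) (fun v h h' => hdis v h' h) hxB hxA hyB hyA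
        (fun u hu w hw huw => hno w hw u hu huw.symm) hq'.1 hq'.2
  -- Case C
  push Not at hA hB
  have hiso : ∀ v ∈ O, G.Adj p₁ v → v = p₂ := by
    intro v hv hpv
    by_contra hne
    obtain ⟨w, hw, hvw, hw1, -⟩ := hA v hv hpv.ne' hne p₁
    obtain ⟨z, hz, hvz, hz1, hzw⟩ := hA v hv hpv.ne' hne w
    have conn : ∀ a ∈ O, ∀ b ∈ O, ∀ c ∈ O, G.Adj v a → G.Adj v b → G.Adj v c → a ≠ c → b ≠ c →
        ConnIn G (S \ {v, c}) a b := by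
      intro a ha b hb c hc hva hvb hvc hac hbc
      refine hB v hv c hc hvc a ?_ b ?_
      · simp [hsub ha, hva.ne', hac]
      · simp [hsub hb, hvb.ne', hbc]
    exact hP.noK5 S O v p₁ w z hPS hv hp₁ hw hz hw1.symm hzw.symm hz1.symm hpv.symm hvw hvz
      (conn _ hp₁ _ hw _ hz hpv.symm hvw hvz hz1.symm hzw.symm)
      (conn _ hw _ hz _ hp₁ hvw hvz hpv.symm hw1 hz1)
      (conn _ hp₁ _ hz _ hw hpv.symm hvz hvw hw1.symm hzw)
  refine ColOn.extend (X := ∅) (D := {c₁}) (v := p₁) (by simp [hL₁]) ?_ (by simp)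
  have hlt : (S.erase p₁).card < n := by
    rw [← hS]; exact Finset.card_erase_lt_of_mem (hsub hp₁)
  refine h1 _ hlt _ _ rfl (hP.del S O p₁ hPS hp₁) _ p₂ ?_ ?_ ?_ ?_
  · simp [hp₂, hp.ne']
  · exact ⟨c₂, by simp [hp, hL₂, hc.symm]⟩
  · intro w hw hwO
    simp only [Finset.mem_erase, Finset.mem_union, Finset.mem_filter] at hw hwO
    have : ¬ G.Adj p₁ w := by tauto
    simp only [this, false_and, if_false]
    exact h5 w hw.2 (by tauto)
  · intro w hw hw2
    simp only [Finset.mem_erase, Finset.mem_union, Finset.mem_filter] at hw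
    split_ifs with hvw
    · have hwO : w ∉ O := fun h => hw2 (hiso w h hvw.1)
      exact card_sdiff_le' _ _ 3 1 (by have := h5 w (by tauto) hwO; omega) (by simp)
    · by_cases hwO : w ∈ O
      · exact h3 w hwO hw.1 hw2
      · have := h5 w (by tauto) hwO; omega

theorem stTwo_all {P : Finset V → Finset V → Prop} (hP : PlaneLike G P) (n : ℕ) :
    StTwo G P n ∧ StOne G P n ∧ StZero G P n := by
  induction n using Nat.strong_induction_on with
  | _ n ih =>
    have h2 := stTwo_of hP n (fun m hm => (ih m hm).1) (fun m hm => (ih m hm).2.1)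
    have h1 := stOne_of hP n h2 (fun m hm => (ih m hm).2.2)
    exact ⟨h2, h1, stZero_of hP n h1 (fun m hm => (ih m hm).2.2)⟩

end Combinatorial

section Topological

variable {V : Type*} {G : SimpleGraph V} (E : PlaneEmbedding G)

/-- The drawing of the subgraph induced on `T`. -/
def drawOn (T : Finset V) : Set (ℝ × ℝ) :=
  {x | (∃ v ∈ T, E.pos v = x) ∨ ∃ e ∈ G.edgeSet, (∀ v ∈ e, v ∈ T) ∧ x ∈ E.arc e}

theorem drawOn_mono {T T' : Finset V} (h : T ⊆ T') : drawOn E T ⊆ drawOn E T' := by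
  rintro x (⟨v, hv, rfl⟩ | ⟨e, he, heT, hx⟩)
  · exact Or.inl ⟨v, h hv, rfl⟩
  · exact Or.inr ⟨e, he, fun v hv => h (heT v hv), hx⟩

theorem drawOn_closed [Finite V] (T : Finset V) : IsClosed (drawOn E T) := by
  have : drawOn E T = E.pos '' T ∪ ⋃ e ∈ {e | e ∈ G.edgeSet ∧ ∀ v ∈ e, v ∈ T}, E.arc e := by
    ext x
    simp [drawOn, and_assoc]
  rw [this]
  refine (T.finite_toSet.image _).isClosed.union ?_
  refine Set.Finite.isClosed_biUnion (Set.toFinite _) ?_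
  rintro e ⟨he, -⟩
  obtain ⟨γ, hγ, -, him, -⟩ := E.arc_is_arc e he
  rw [← him]
  exact (isCompact_Icc.image_of_continuousOn hγ).isClosed

theorem drawOn_isBounded [Finite V] (T : Finset V) : Bornology.IsBounded (drawOn E T) := by
  have : drawOn E T = E.pos '' T ∪ ⋃ e ∈ {e | e ∈ G.edgeSet ∧ ∀ v ∈ e, v ∈ T}, E.arc e := by
    ext x
    simp [drawOn, and_assoc]
  rw [this]
  refine (T.finite_toSet.image _).isBounded.union ?_
  refine (Bornology.isBounded_biUnion (Set.toFinite _)).2 ?_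
  rintro e ⟨he, -⟩
  obtain ⟨γ, hγ, -, him, -⟩ := E.arc_is_arc e he
  rw [← him]
  exact (isCompact_Icc.image_of_continuousOn hγ).isBounded

theorem drawOn_disjoint {T T' : Finset V} (h : ∀ v ∈ T, v ∉ T') (x : ℝ × ℝ)
    (hx : x ∈ drawOn E T) (hx' : x ∈ drawOn E T') : False := by
  rcases hx with ⟨v, hv, rfl⟩ | ⟨e, he, heT, hx⟩
  · rcases hx' with ⟨w, hw, hwv⟩ | ⟨f, hf, hfT, hx'⟩
    · exact h v hv (E.pos_inj hwv ▸ hw)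
    · exact h v hv (hfT v (E.arc_inter_pos f hf v hx'))
  · rcases hx' with ⟨w, hw, rfl⟩ | ⟨f, hf, hfT, hx'⟩
    · exact h w (heT w (E.arc_inter_pos e he w hx)) hw
    · by_cases hef : e = f
      · subst hef
        induction e using Sym2.ind with
        | _ a b => exact h a (heT a (by simp)) (hfT a (by simp))
      · obtain ⟨v, hv, hv', -⟩ := E.arc_inter_arc e he f hf hef x ⟨hx, hx'⟩
        exact h v (heT v hv) (hfT v hv')

theorem pos_notMem_drawOn {T : Finset V} {v : V} (hv : v ∉ T) : E.pos v ∉ drawOn E T := by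
  intro h
  refine drawOn_disjoint E (T := {v}) (T' := T) (by simpa using hv) _ ?_ h
  exact Or.inl ⟨v, by simp, rfl⟩

/-- A parametrization of an edge starting from a prescribed end. -/
theorem exists_param {v w : V} (h : G.Adj v w) : ∃ γ : ℝ → ℝ × ℝ,
    ContinuousOn γ (Icc 0 1) ∧ InjOn γ (Icc 0 1) ∧ γ '' (Icc 0 1) = E.arc s(v, w) ∧
    γ 0 = E.pos v ∧ γ 1 = E.pos w := by
  obtain ⟨γ, hγ, hinj, him, hend⟩ := E.arc_is_arc s(v, w) h
  have he := hend v w rfl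
  have hne : E.pos v ≠ E.pos w := fun h' => h.ne (E.pos_inj h')
  have h0 : γ 0 = E.pos v ∨ γ 0 = E.pos w := by
    have : γ 0 ∈ ({γ 0, γ 1} : Set (ℝ × ℝ)) := by simp
    rw [he] at this; simpa using this
  have h1 : γ 1 = E.pos v ∨ γ 1 = E.pos w := by
    have : γ 1 ∈ ({γ 0, γ 1} : Set (ℝ × ℝ)) := by simp
    rw [he] at this; simpa using this
  have h01 : γ 0 ≠ γ 1 := fun h' => by
    simpa using hinj (by simp) (by simp) h'
  rcases h0 with h0 | h0
  · refine ⟨γ, hγ, hinj, him, h0, ?_⟩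
    rcases h1 with h1 | h1
    · exact absurd (h0.trans h1.symm) h01
    · exact h1
  · have h1' : γ 1 = E.pos v := by
      rcases h1 with h1 | h1
      · exact h1
      · exact absurd (h0.trans h1.symm) h01
    have hmap : MapsTo (fun t : ℝ => 1 - t) (Icc 0 1) (Icc 0 1) := by
      intro t ht; simp only [mem_Icc] at ht ⊢; constructor <;> linarith [ht.1, ht.2]
    refine ⟨fun t => γ (1 - t), hγ.comp (by fun_prop) hmap, ?_, ?_, by simpa using h1',
      by simpa using h0⟩
    · intro s hs t ht hst
      have := hinj (hmap hs) (hmap ht) hst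
      linarith
    · rw [← him]
      ext x
      constructor
      · rintro ⟨t, ht, rfl⟩
        exact ⟨1 - t, hmap ht, rfl⟩
      · rintro ⟨t, ht, rfl⟩
        exact ⟨1 - t, hmap ht, by simp⟩

theorem pos_mem_arc {v w : V} (h : G.Adj v w) : E.pos v ∈ E.arc s(v, w) := by
  obtain ⟨γ, -, -, him, h0, -⟩ := exists_param E h
  rw [← him, ← h0]
  exact ⟨0, by simp, rfl⟩

theorem joinedIn_arc {v w : V} (h : G.Adj v w) :
    JoinedIn (E.arc s(v, w)) (E.pos v) (E.pos w) := by
  obtain ⟨γ, hγ, -, him, h0, h1⟩ := exists_param E h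
  have hpc : IsPathConnected (γ '' Icc 0 1) :=
    ((convex_Icc (0 : ℝ) 1).isPathConnected ⟨0, by simp⟩).image' hγ
  rw [← him, ← h0, ← h1]
  exact hpc.joinedIn _ ⟨0, by simp, rfl⟩ _ ⟨1, by simp, rfl⟩

theorem arc_subset_drawOn {T : Finset V} {v w : V} (h : G.Adj v w) (hv : v ∈ T) (hw : w ∈ T) :
    E.arc s(v, w) ⊆ drawOn E T := by
  intro x hx
  refine Or.inr ⟨s(v, w), h, ?_, hx⟩
  intro u hu
  rcases Sym2.mem_iff.1 hu with rfl | rfl <;> assumption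

theorem joinedIn_of_connIn {T : Finset V} {a b : V} (ha : a ∈ T) (h : ConnIn G T a b) :
    b ∈ T ∧ JoinedIn (drawOn E T) (E.pos a) (E.pos b) := by
  induction h with
  | refl => exact ⟨ha, JoinedIn.refl (Or.inl ⟨a, ha, rfl⟩)⟩
  | tail _ hbc ih =>
    exact ⟨hbc.2, ih.2.trans ((joinedIn_arc E hbc.1).mono
      (arc_subset_drawOn E hbc.1 ih.1 hbc.2))⟩

/-- Neighbors of a deleted vertex are incident with the face containing that vertex. -/
theorem nbr_face {T : Finset V} {v w : V} (hv : v ∉ T) (h : G.Adj v w) :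
    E.pos w ∈ closure (connectedComponentIn (drawOn E T)ᶜ (E.pos v)) := by
  obtain ⟨γ, hγ, hinj, him, h0, h1⟩ := exists_param E h
  have hpre : IsPreconnected (γ '' Ico 0 1) :=
    isPreconnected_Ico.image _ (hγ.mono Ico_subset_Icc_self)
  have hsub : γ '' Ico 0 1 ⊆ (drawOn E T)ᶜ := by
    rintro x ⟨t, ht, rfl⟩ hx
    have hta : γ t ∈ E.arc s(v, w) := by
      rw [← him]; exact ⟨t, Ico_subset_Icc_self ht, rfl⟩
    have hne : γ t ≠ E.pos w := by
      rw [← h1]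
      intro h'
      have := hinj (Ico_subset_Icc_self ht) (by simp) h'
      exact ht.2.ne this
    rcases hx with ⟨u, hu, hux⟩ | ⟨f, hf, hfT, hx⟩
    · have := E.arc_inter_pos s(v, w) h u (hux ▸ hta)
      rcases Sym2.mem_iff.1 this with rfl | rfl
      · exact hv hu
      · exact hne hux.symm
    · have hef : s(v, w) ≠ f := by
        rintro rfl; exact hv (hfT v (by simp))
      obtain ⟨u, hu, hu', hux⟩ := E.arc_inter_arc _ h f hf hef _ ⟨hta, hx⟩
      rcases Sym2.mem_iff.1 hu with rfl | rfl
      · exact hv (hfT _ hu')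
      · exact hne hux.symm
  have hmem : E.pos v ∈ γ '' Ico 0 1 := ⟨0, by simp, h0⟩
  refine closure_mono (hpre.subset_connectedComponentIn hmem hsub) ?_
  rw [← h1]
  have hc : ContinuousWithinAt γ (Ico 0 1) 1 :=
    (hγ 1 (by simp)).mono Ico_subset_Icc_self
  refine hc.mem_closure_image ?_
  rw [closure_Ico (by norm_num)]
  simp

/-- A deleted vertex incident with a face lies in the new face. -/
theorem mem_face {S T : Finset V} {v : V} {x₀ : ℝ × ℝ} (hTS : T ⊆ S) (hv : v ∉ T)
    (hx₀ : x₀ ∉ drawOn E S)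
    (h : E.pos v ∈ closure (connectedComponentIn (drawOn E S)ᶜ x₀)) :
    E.pos v ∈ connectedComponentIn (drawOn E T)ᶜ x₀ := by
  set U := connectedComponentIn (drawOn E S)ᶜ x₀
  have hU : IsPreconnected (insert (E.pos v) U) :=
    isPreconnected_connectedComponentIn.subset_closure (subset_insert _ _)
      (insert_subset h subset_closure)
  refine hU.subset_connectedComponentIn (Or.inr (mem_connectedComponentIn hx₀)) ?_
    (mem_insert _ _)
  refine insert_subset (pos_notMem_drawOn E hv) ?_
  exact (connectedComponentIn_subset _ _).trans (compl_subset_compl.2 (drawOn_mono E hTS))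

/-- `O` is a set of vertices of `S` incident with a common face of the drawing of `G[S]`. -/
def FaceP (S O : Finset V) : Prop :=
  O ⊆ S ∧ ∃ x₀ ∉ drawOn E S, ∀ o ∈ O,
    E.pos o ∈ closure (connectedComponentIn (drawOn E S)ᶜ x₀)

theorem curve_of_joinedIn {K : Set (ℝ × ℝ)} {p q : ℝ × ℝ} (h : JoinedIn K p q) :
    ∃ f : ℝ → ℂ, IsCurve f (Complex.equivRealProdCLM.symm p) (Complex.equivRealProdCLM.symm q) ∧
      ∀ t, Complex.equivRealProdCLM (f t) ∈ K := by
  refine ⟨fun t => Complex.equivRealProdCLM.symm (h.somePath.extend t), ⟨?_, ?_, ?_⟩, ?_⟩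
  · exact Complex.equivRealProdCLM.symm.continuous.comp h.somePath.continuous_extend
  · simp
  · simp
  · intro t
    simp only [ContinuousLinearEquiv.apply_symm_apply]
    exact h.somePath_mem _

theorem disj_of {K K' : Set (ℝ × ℝ)} {f g : ℝ → ℂ}
    (hf : ∀ t, Complex.equivRealProdCLM (f t) ∈ K)
    (hg : ∀ t, Complex.equivRealProdCLM (g t) ∈ K') (h : ∀ x ∈ K, x ∉ K') : CurveDisj f g := by
  intro s t hst
  exact h _ (hf s) (hst ▸ hg t)

theorem FaceP.joined [Finite V] {S T : Finset V} {v : V} {x₀ : ℝ × ℝ} (hTS : T ⊆ S) (hv : v ∉ T)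
    (hx₀ : x₀ ∉ drawOn E S)
    (h : E.pos v ∈ closure (connectedComponentIn (drawOn E S)ᶜ x₀)) :
    JoinedIn (drawOn E T)ᶜ x₀ (E.pos v) := by
  have hm := mem_face E hTS hv hx₀ h
  have hx : x₀ ∈ (drawOn E T)ᶜ := fun h' => hx₀ (drawOn_mono E hTS h')
  have ho : IsOpen (connectedComponentIn (drawOn E T)ᶜ x₀) :=
    (drawOn_closed E T).isOpen_compl.connectedComponentIn
  have hc : IsConnected (connectedComponentIn (drawOn E T)ᶜ x₀) :=
    isConnected_connectedComponentIn_iff.2 hx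
  have hp := ho.isConnected_iff_isPathConnected.1 hc
  exact (hp.joinedIn _ (mem_connectedComponentIn hx) _ hm).mono (connectedComponentIn_subset _ _)

open Classical in
theorem planeLike_faceP [Finite V] : PlaneLike G (FaceP E) where
  sub S O h := h.1
  mono S O S' h hS := by
    obtain ⟨hO, x₀, hx₀, h⟩ := h
    refine ⟨Finset.inter_subset_right, x₀, fun h' => hx₀ (drawOn_mono E hS h'), ?_⟩
    intro o ho
    exact closure_mono (connectedComponentIn_mono _
      (compl_subset_compl.2 (drawOn_mono E hS))) (h o (Finset.mem_inter.1 ho).1)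
  del S O v h hv := by
    obtain ⟨hO, x₀, hx₀, h⟩ := h
    have hS : S.erase v ⊆ S := Finset.erase_subset _ _
    refine ⟨?_, x₀, fun h' => hx₀ (drawOn_mono E hS h'), ?_⟩
    · refine Finset.erase_subset_erase _ (Finset.union_subset hO (Finset.filter_subset _ _))
    · intro o ho
      simp only [Finset.mem_erase, Finset.mem_union, Finset.mem_filter] at ho
      rcases ho.2 with ho | ho
      · exact closure_mono (connectedComponentIn_mono _
          (compl_subset_compl.2 (drawOn_mono E hS))) (h o ho)
      · rw [connectedComponentIn_eq
          (mem_face E hS (Finset.notMem_erase v S) hx₀ (h v hv))]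
        exact nbr_face E (Finset.notMem_erase v S) ho.2
  del' S O v h hv := by
    refine ⟨?_, E.pos v, pos_notMem_drawOn E (Finset.notMem_erase v S), ?_⟩
    · intro w hw
      simp only [Finset.mem_filter] at hw
      simp [hw.1, hw.2.ne']
    · intro w hw
      simp only [Finset.mem_filter] at hw
      exact nbr_face E (Finset.notMem_erase v S) hw.2
  noK5 S O v a b c h hv ha hb hc hab hbc hac va vb vc cab cbc cac := by
    obtain ⟨hO, x₀, hx₀, h⟩ := h
    have out : ∀ o ∈ O, JoinedIn (drawOn E (S.erase o))ᶜ x₀ (E.pos o) := fun o ho =>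
      FaceP.joined E (Finset.erase_subset _ _) (Finset.notMem_erase o S) hx₀ (h o ho)
    have spoke : ∀ w, G.Adj v w → JoinedIn (drawOn E {v, w}) (E.pos v) (E.pos w) := fun w hw =>
      (joinedIn_arc E hw).mono (arc_subset_drawOn E hw (by simp) (by simp))
    obtain ⟨e01, c01, k01⟩ := curve_of_joinedIn (out v hv)
    obtain ⟨e02, c02, k02⟩ := curve_of_joinedIn (out a ha)
    obtain ⟨e03, c03, k03⟩ := curve_of_joinedIn (out b hb)
    obtain ⟨e04, c04, k04⟩ := curve_of_joinedIn (out c hc)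
    obtain ⟨e12, c12, k12⟩ := curve_of_joinedIn (spoke a va)
    obtain ⟨e13, c13, k13⟩ := curve_of_joinedIn (spoke b vb)
    obtain ⟨e14, c14, k14⟩ := curve_of_joinedIn (spoke c vc)
    obtain ⟨e23, c23, k23⟩ := curve_of_joinedIn
      (joinedIn_of_connIn E (by simp [hO ha, va.ne', hac]) cab).2
    obtain ⟨e24, c24, k24⟩ := curve_of_joinedIn
      (joinedIn_of_connIn E (by simp [hO ha, va.ne', hab]) cac).2
    obtain ⟨e34, c34, k34⟩ := curve_of_joinedIn
      (joinedIn_of_connIn E (by simp [hO hb, vb.ne', hab.symm]) cbc).2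
    have far : ∀ (o : V) (T : Finset V), T ⊆ S → o ∉ T →
        ∀ x ∈ (drawOn E (S.erase o))ᶜ, x ∉ drawOn E T := by
      intro o T hT ho x hx hx'
      have hsub : T ⊆ S.erase o := by
        intro u hu
        refine Finset.mem_erase.2 ⟨?_, hT hu⟩
        intro h
        rw [h] at hu
        exact ho hu
      exact hx (drawOn_mono E hsub hx')
    have hpair : ∀ w ∈ O, ({v, w} : Finset V) ⊆ S := by
      intro w hw u hu
      simp only [Finset.mem_insert, Finset.mem_singleton] at hu
      rcases hu with rfl | rfl
      · exact hO hv
      · exact hO hw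
    have near : ∀ w, ∀ x ∈ drawOn E {v, w}, x ∉ drawOn E (S \ {v, w}) := by
      intro w x hx hx'
      refine drawOn_disjoint E ?_ x hx hx'
      intro u hu hu'
      exact (Finset.mem_sdiff.1 hu').2 hu
    refine no_k5 c01 c02 c03 c04 c12 c13 c14 c23 c24 c34
      (disj_of k01 k23 (far v _ Finset.sdiff_subset (by simp)))
      (disj_of k01 k24 (far v _ Finset.sdiff_subset (by simp)))
      (disj_of k01 k34 (far v _ Finset.sdiff_subset (by simp)))
      (disj_of k02 k13 (far a _ (hpair b hb) (by simp [va.ne', hab])))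
      (disj_of k02 k14 (far a _ (hpair c hc) (by simp [va.ne', hac])))
      (disj_of k02 k34 (far a _ Finset.sdiff_subset (by simp)))
      (disj_of k03 k12 (far b _ (hpair a ha) (by simp [vb.ne', hab.symm])))
      (disj_of k03 k14 (far b _ (hpair c hc) (by simp [vb.ne', hbc])))
      (disj_of k03 k24 (far b _ Finset.sdiff_subset (by simp)))
      (disj_of k04 k12 (far c _ (hpair a ha) (by simp [vc.ne', hac.symm])))
      (disj_of k04 k13 (far c _ (hpair b hb) (by simp [vc.ne', hbc.symm])))
      (disj_of k04 k23 (far c _ Finset.sdiff_subset (by simp)))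
      (disj_of k12 k34 (near a))
      (disj_of k13 k24 (near b))
      (disj_of k14 k23 (near c))

theorem isPreconnected_norm_gt (R : ℝ) (hR : 0 ≤ R) :
    IsPreconnected {x : ℝ × ℝ | R < ‖x‖} := by
  have h0 : IsPreconnected ({0}ᶜ : Set (ℝ × ℝ)) :=
    (isConnected_compl_singleton_of_one_lt_rank (by
      simp only [rank_prod', Module.rank_self, one_add_one_eq_two]; exact Cardinal.one_lt_two) 0).isPreconnected
  have him : (fun x : ℝ × ℝ => (1 + R / ‖x‖) • x) '' {0}ᶜ = {x | R < ‖x‖} := by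
    ext y
    simp only [mem_image, mem_compl_iff, mem_singleton_iff, mem_setOf_eq]
    constructor
    · rintro ⟨x, hx, rfl⟩
      have hx' : 0 < ‖x‖ := norm_pos_iff.2 hx
      rw [norm_smul, Real.norm_of_nonneg (by positivity)]
      field_simp
      linarith
    · intro hy
      have hy' : 0 < ‖y‖ := lt_of_le_of_lt hR hy
      have hk : 0 < 1 - R / ‖y‖ := by rw [sub_pos, div_lt_one hy']; exact hy
      refine ⟨(1 - R / ‖y‖) • y, smul_ne_zero hk.ne' (norm_pos_iff.1 hy'), ?_⟩
      rw [norm_smul, Real.norm_of_nonneg hk.le, smul_smul]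
      have h1 : (1 - R / ‖y‖) * ‖y‖ = ‖y‖ - R := by field_simp
      rw [h1]
      have h2 : ‖y‖ - R ≠ 0 := by linarith
      have h3 : (1 + R / (‖y‖ - R)) * (1 - R / ‖y‖) = 1 := by field_simp; ring
      rw [h3, one_smul]
  rw [← him]
  refine h0.image _ ?_
  intro x hx
  have : ‖x‖ ≠ 0 := norm_ne_zero_iff.2 hx
  exact ((continuousAt_const.add (continuousAt_const.div continuous_norm.continuousAt this)).smul
    continuousAt_id).continuousWithinAt

theorem outerFace_subset [Fintype V] : ∃ x₀ ∉ drawOn E Finset.univ,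
    E.outerFace ⊆ connectedComponentIn (drawOn E Finset.univ)ᶜ x₀ := by
  have him : E.image = drawOn E Finset.univ := by
    ext x; simp [PlaneEmbedding.image, drawOn]
  obtain ⟨R, hRpos, hR⟩ := (drawOn_isBounded E Finset.univ).exists_pos_norm_le
  have hsub : {x : ℝ × ℝ | R < ‖x‖} ⊆ (drawOn E Finset.univ)ᶜ := by
    intro x hx hx'
    exact absurd (hR x hx') (not_le.2 hx)
  have hx₀ : ((R + 1, 0) : ℝ × ℝ) ∈ {x : ℝ × ℝ | R < ‖x‖} := by
    simp only [mem_setOf_eq, Prod.norm_def]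
    refine lt_max_of_lt_left ?_
    rw [Real.norm_of_nonneg (by linarith)]
    linarith
  refine ⟨(R + 1, 0), hsub hx₀, ?_⟩
  rintro x ⟨hx, hunb⟩
  rw [him] at hx hunb
  obtain ⟨y, hy, hyR⟩ : ∃ y ∈ connectedComponentIn (drawOn E Finset.univ)ᶜ x, R < ‖y‖ := by
    by_contra! hcon
    exact hunb (isBounded_iff_forall_norm_le.2 ⟨R, hcon⟩)
  have h1 := (isPreconnected_norm_gt R hRpos.le).subset_connectedComponentIn hx₀ hsub hyR
  rw [connectedComponentIn_eq h1, ← connectedComponentIn_eq hy]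
  exact mem_connectedComponentIn hx

end Topological

/-- Thomassen's theorem with a precolored edge on the outer cycle. -/
theorem thomassen_precolored_edge {V : Type} [Fintype V] (G : SimpleGraph V)
    (E : PlaneEmbedding G) {w : V} (C : G.Walk w w) (hC : E.IsOuterCycle C)
    (p₁ p₂ : V) (hP : s(p₁, p₂) ∈ C.edges)
    (L : V → Finset ℕ) (hL0 : ∀ v : V, (L v).Nonempty)
    (h5 : ∀ v : V, v ∉ C.support → 5 ≤ (L v).card)
    (h3 : ∀ v ∈ C.support, v ≠ p₁ → v ≠ p₂ → 3 ≤ (L v).card)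
    (h1 : (L p₁).card = 1) (h2 : (L p₂).card = 1) (hne : L p₁ ≠ L p₂) :
    ∃ φ : V → ℕ, IsLColoring G L φ := by
  classical
  obtain ⟨hcyc, hfr⟩ := hC
  obtain ⟨x₀, hx₀, hout⟩ := outerFace_subset E
  obtain ⟨c₁, hc₁⟩ := Finset.card_eq_one.1 h1
  obtain ⟨c₂, hc₂⟩ := Finset.card_eq_one.1 h2
  have hadj : G.Adj p₁ p₂ := C.adj_of_mem_edges hP
  have hP' : FaceP E Finset.univ (Finset.univ.filter (· ∈ C.support)) := by
    refine ⟨Finset.subset_univ _, x₀, hx₀, ?_⟩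
    intro o ho
    have ho : o ∈ C.support := by simpa using ho
    refine closure_mono hout (frontier_subset_closure ?_)
    rw [← hfr]
    obtain ⟨e, he, hoe⟩ := (SimpleGraph.Walk.mem_support_iff_exists_mem_edges_of_not_nil
      hcyc.not_nil).1 ho
    refine mem_biUnion (x := e) he ?_
    obtain ⟨u, rfl⟩ := Sym2.mem_iff_exists.1 hoe
    exact pos_mem_arc E (C.adj_of_mem_edges he)
  obtain ⟨φ, hφ1, hφ2⟩ := (stTwo_all (planeLike_faceP E) _).1 Finset.univ _ rfl hP' L p₁ p₂ c₁ c₂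
    (by simpa using C.fst_mem_support_of_mem_edges hP)
    (by simpa using C.snd_mem_support_of_mem_edges hP) hadj hc₁ hc₂
    (by rintro rfl; exact hne (hc₁.trans hc₂.symm))
    (fun v _ hv => h5 v (by simpa using hv))
    (fun v hv => h3 v (by simpa using hv))
  exact ⟨φ, fun v => hφ1 v (Finset.mem_univ v), fun u w huw =>
    hφ2 u (Finset.mem_univ u) w (Finset.mem_univ w) huw⟩
end

section
/- If (G, P, L) is a canvas in which P is a path of length one (i.e., with exactly two vertices joined by an edge), then G is L-colorable. -/
open Set Topology

theorem exists_log {A : Type*} [TopologicalSpace A] [SimplyConnectedSpace A]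
    [LocallyPathConnectedSpace A] (a₀ : A) (g : A → ℂ) (hg : Continuous g) (h0 : ∀ a, g a ≠ 0) :
    ∃ h : A → ℂ, Continuous h ∧ ∀ a, Complex.exp (h a) = g a := by
  obtain ⟨F, ⟨-, hF⟩, -⟩ := Complex.isCoveringMapOn_exp.existsUnique_continuousMap_lifts
    (⟨g, hg⟩ : C(A, ℂ)) (a₀ := a₀) (e₀ := Complex.log (g a₀))
    (by simpa using Complex.exp_log (h0 a₀)) (by intro a; simpa using h0 a)
  exact ⟨F, F.continuous, fun a => congrFun hF a⟩

theorem log_diff_unique (h₁ h₂ : ℝ → ℂ) (c₁ : Continuous h₁) (c₂ : Continuous h₂) (c : ℂ)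
    (h : ∀ t, Complex.exp (h₁ t) = c * Complex.exp (h₂ t)) :
    h₁ 1 - h₁ 0 = h₂ 1 - h₂ 0 := by
  have key := Complex.isCoveringMap_exp.const_of_comp (g := fun t : ℝ => h₁ t - h₂ t)
    (by fun_prop) (by
      intro a b
      apply Subtype.ext
      simp only [Complex.exp_sub, h]
      field_simp [Complex.exp_ne_zero]) 1 0
  linear_combination key

/-- Change of the logarithm along the path `γ`, seen from `p`. -/
def IsTurn (p : ℂ) (γ : ℝ → ℂ) (A : ℂ) : Prop :=
  ∃ h : ℝ → ℂ, Continuous h ∧ (∀ t, Complex.exp (h t) = γ t - p) ∧ h 1 - h 0 = A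

theorem IsTurn.unique {p : ℂ} {γ : ℝ → ℂ} {A : ℂ} (hA : IsTurn p γ A) (h : ℝ → ℂ)
    (hc : Continuous h) (c : ℂ) (he : ∀ t, Complex.exp (h t) = c * (γ t - p)) :
    h 1 - h 0 = A := by
  obtain ⟨k, kc, ke, rfl⟩ := hA
  exact log_diff_unique h k hc kc c (by simpa [ke] using he)

theorem turn_cell {γ δ : ℝ → ℂ} (hγ : Continuous γ) (hδ : Continuous δ)
    (hd : ∀ s t, γ s ≠ δ t) {a₁ a₂ a₃ a₄ : ℂ}
    (h₁ : IsTurn (γ 0) δ a₁) (h₂ : IsTurn (γ 1) δ a₂)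
    (h₃ : IsTurn (δ 0) γ a₃) (h₄ : IsTurn (δ 1) γ a₄) : a₁ - a₂ = a₃ - a₄ := by
  obtain ⟨H, Hc, He⟩ := exists_log ((0, 0) : ℝ × ℝ) (fun q => δ q.2 - γ q.1)
    (by fun_prop) (fun q => sub_ne_zero.2 (hd q.1 q.2).symm)
  have e₁ := h₁.unique (fun t => H (0, t)) (by fun_prop) 1 (by intro t; simp [He])
  have e₂ := h₂.unique (fun t => H (1, t)) (by fun_prop) 1 (by intro t; simp [He])
  have e₃ := h₃.unique (fun t => H (t, 0)) (by fun_prop) (-1) (by intro t; simp [He])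
  have e₄ := h₄.unique (fun t => H (t, 1)) (by fun_prop) (-1) (by intro t; simp [He])
  linear_combination -e₁ + e₂ + e₃ - e₄

theorem exists_turn (p : ℂ) (γ : ℝ → ℂ) (hγ : Continuous γ) (h : ∀ t, γ t ≠ p) :
    ∃ A, IsTurn p γ A := by
  obtain ⟨k, kc, ke⟩ := exists_log (0 : ℝ) (fun t => γ t - p) (by fun_prop)
    (fun t => sub_ne_zero.2 (h t))
  exact ⟨_, k, kc, ke, rfl⟩

theorem IsTurn.int {p : ℂ} {γ : ℝ → ℂ} {A : ℂ} (hA : IsTurn p γ A) (a b : ℂ)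
    (ha : Complex.exp a = γ 0 - p) (hb : Complex.exp b = γ 1 - p) :
    ∃ n : ℤ, A = b - a + n * (2 * Real.pi * Complex.I) := by
  obtain ⟨k, kc, ke, rfl⟩ := hA
  obtain ⟨n, hn⟩ := Complex.exp_eq_exp_iff_exists_int.1 ((ke 0).trans ha.symm)
  obtain ⟨m, hm⟩ := Complex.exp_eq_exp_iff_exists_int.1 ((ke 1).trans hb.symm)
  exact ⟨m - n, by rw [hn, hm]; push_cast; ring⟩

/-- A strong form of the non-planarity of `K₅`: continuous curves joining five points pairwise
cannot be such that curves of vertex-disjoint pairs are disjoint. -/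
theorem K5_complex (P : Fin 5 → ℂ) (γ : Fin 5 → Fin 5 → ℝ → ℂ)
    (hc : ∀ i j, i < j → Continuous (γ i j))
    (h0 : ∀ i j, i < j → γ i j 0 = P i) (h1 : ∀ i j, i < j → γ i j 1 = P j)
    (hd : ∀ i j k l, i < j → k < l → i ≠ k → i ≠ l → j ≠ k → j ≠ l →
      ∀ s t, γ i j s ≠ γ k l t) : False := by
  have hne : ∀ v a b, a < b → v ≠ a → v ≠ b → ∀ t, γ a b t ≠ P v := by
    intro v a b hab hva hvb t
    have : ∃ w : Fin 5, w ≠ v ∧ w ≠ a ∧ w ≠ b := by revert v a b; decide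
    obtain ⟨w, hwv, hwa, hwb⟩ := this
    rcases lt_or_gt_of_ne hwv with h | h
    · rw [← h1 w v h]
      exact hd a b w v hab h hwa.symm hva.symm hwb.symm hvb.symm t 1
    · rw [← h0 v w h]
      exact hd a b v w hab h hva.symm hwa.symm hvb.symm hwb.symm t 0
  have hPne : ∀ a b, a < b → P b - P a ≠ 0 := by
    intro a b hab
    have : ∃ w : Fin 5, w ≠ a ∧ w ≠ b := by revert a b; decide
    obtain ⟨w, hwa, hwb⟩ := this
    rcases lt_or_gt_of_ne hwb with h | h
    · rw [← h1 w b h]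
      exact sub_ne_zero.2 (hne a w b h hwa.symm hab.ne 1)
    · rw [← h0 b w h]
      exact sub_ne_zero.2 (hne a b w h hab.ne hwa.symm 0)
  let α : Fin 5 → Fin 5 → ℂ := fun a b =>
    if a < b then Complex.log (P b - P a) else Complex.log (P a - P b) + Real.pi * Complex.I
  have hα : ∀ a b, a ≠ b → Complex.exp (α a b) = P b - P a := by
    intro a b hab
    rcases lt_or_gt_of_ne hab with h | h
    · simp only [α, if_pos h, Complex.exp_log (hPne a b h)]
    · simp only [α, if_neg h.not_gt, Complex.exp_add, Complex.exp_log (hPne b a h),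
        Complex.exp_pi_mul_I]
      ring
  have hα' : ∀ a b, a < b → α b a = α a b + Real.pi * Complex.I := by
    intro a b h
    simp only [α, if_pos h, if_neg h.not_gt]
  have hT : ∀ v a b, ∃ A, a < b → v ≠ a → v ≠ b → IsTurn (P v) (γ a b) A := by
    intro v a b
    by_cases h : a < b ∧ v ≠ a ∧ v ≠ b
    · obtain ⟨A, hA⟩ := exists_turn (P v) (γ a b) (hc a b h.1) (hne v a b h.1 h.2.1 h.2.2)
      exact ⟨A, fun _ _ _ => hA⟩
    · exact ⟨0, fun h1 h2 h3 => absurd ⟨h1, h2, h3⟩ h⟩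
  choose A hA using hT
  have hN : ∀ v a b, ∃ n : ℤ, a < b → v ≠ a → v ≠ b →
      A v a b = α v b - α v a + n * (2 * Real.pi * Complex.I) := by
    intro v a b
    by_cases h : a < b ∧ v ≠ a ∧ v ≠ b
    · obtain ⟨n, hn⟩ := (hA v a b h.1 h.2.1 h.2.2).int (α v a) (α v b)
        (by rw [hα _ _ h.2.1, h0 _ _ h.1]) (by rw [hα _ _ h.2.2, h1 _ _ h.1])
      exact ⟨n, fun _ _ _ => hn⟩
    · exact ⟨0, fun h1 h2 h3 => absurd ⟨h1, h2, h3⟩ h⟩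
  choose N hN using hN
  let σ : Fin 5 → Fin 5 → ℤ := fun a b => if a < b then -1 else 1
  have hσ : ∀ a b, a ≠ b → α a b - α b a = (σ a b : ℂ) * (Real.pi * Complex.I) := by
    intro a b hab
    rcases lt_or_gt_of_ne hab with h | h
    · simp [σ, if_pos h, hα' a b h]
    · simp [σ, if_neg h.not_gt, hα' b a h]
  have cell : ∀ i j k l, i < j → k < l → i ≠ k → i ≠ l → j ≠ k → j ≠ l →
      σ i l - σ i k - σ j l + σ j k + 2 * (N i k l - N j k l - N k i j + N l i j) = 0 := by
    intro i j k l hij hkl hik hil hjk hjl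
    have h := turn_cell (hc i j hij) (hc k l hkl) (hd i j k l hij hkl hik hil hjk hjl)
      (a₁ := A i k l) (a₂ := A j k l) (a₃ := A k i j) (a₄ := A l i j)
      (by rw [h0 _ _ hij]; exact hA _ _ _ hkl hik hil)
      (by rw [h1 _ _ hij]; exact hA _ _ _ hkl hjk hjl)
      (by rw [h0 _ _ hkl]; exact hA _ _ _ hij hik.symm hjk.symm)
      (by rw [h1 _ _ hkl]; exact hA _ _ _ hij hil.symm hjl.symm)
    rw [hN _ _ _ hkl hik hil, hN _ _ _ hkl hjk hjl, hN _ _ _ hij hik.symm hjk.symm,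
      hN _ _ _ hij hil.symm hjl.symm] at h
    have hpi : (Real.pi * Complex.I : ℂ) ≠ 0 := by
      simp [Real.pi_ne_zero]
    have h2 : ((σ i l - σ i k - σ j l + σ j k
        + 2 * (N i k l - N j k l - N k i j + N l i j) : ℤ) : ℂ) * (Real.pi * Complex.I) = 0 := by
      push_cast
      linear_combination h - hσ i l hil + hσ i k hik + hσ j l hjl - hσ j k hjk
    exact_mod_cast (mul_eq_zero.1 h2).resolve_right hpi
  have c01 := cell 0 1 2 3 (by decide) (by decide) (by decide) (by decide) (by decide) (by decide)
  have c02 := cell 0 1 2 4 (by decide) (by decide) (by decide) (by decide) (by decide) (by decide)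
  have c03 := cell 0 1 3 4 (by decide) (by decide) (by decide) (by decide) (by decide) (by decide)
  have c04 := cell 0 2 1 3 (by decide) (by decide) (by decide) (by decide) (by decide) (by decide)
  have c05 := cell 0 2 1 4 (by decide) (by decide) (by decide) (by decide) (by decide) (by decide)
  have c06 := cell 0 2 3 4 (by decide) (by decide) (by decide) (by decide) (by decide) (by decide)
  have c07 := cell 0 3 1 2 (by decide) (by decide) (by decide) (by decide) (by decide) (by decide)
  have c08 := cell 0 3 1 4 (by decide) (by decide) (by decide) (by decide) (by decide) (by decide)
  have c09 := cell 0 3 2 4 (by decide) (by decide) (by decide) (by decide) (by decide) (by decide)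
  have c10 := cell 0 4 1 2 (by decide) (by decide) (by decide) (by decide) (by decide) (by decide)
  have c11 := cell 0 4 1 3 (by decide) (by decide) (by decide) (by decide) (by decide) (by decide)
  have c12 := cell 0 4 2 3 (by decide) (by decide) (by decide) (by decide) (by decide) (by decide)
  have c13 := cell 1 2 3 4 (by decide) (by decide) (by decide) (by decide) (by decide) (by decide)
  have c14 := cell 1 3 2 4 (by decide) (by decide) (by decide) (by decide) (by decide) (by decide)
  have c15 := cell 1 4 2 3 (by decide) (by decide) (by decide) (by decide) (by decide) (by decide)
  simp [σ] at c01 c02 c03 c04 c05 c06 c07 c08 c09 c10 c11 c12 c13 c14 c15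
  omega

theorem K5_plane (P : Fin 5 → ℝ × ℝ) (K : Fin 5 → Fin 5 → Set (ℝ × ℝ))
    (hJ : ∀ i j, i < j → JoinedIn (K i j) (P i) (P j))
    (hd : ∀ i j k l, i < j → k < l → i ≠ k → i ≠ l → j ≠ k → j ≠ l →
      Disjoint (K i j) (K k l)) : False := by
  have : ∀ i j, ∃ γ : ℝ → ℝ × ℝ, i < j →
      Continuous γ ∧ γ 0 = P i ∧ γ 1 = P j ∧ ∀ t, γ t ∈ K i j := by
    intro i j
    by_cases h : i < j
    · obtain ⟨p, hp⟩ := hJ i j h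
      refine ⟨p.extend, fun _ => ⟨p.continuous_extend, by simp, by simp, fun t => ?_⟩⟩
      have : p.extend t ∈ range p.extend := mem_range_self t
      rw [Path.extend_range] at this
      obtain ⟨s, hs⟩ := this
      rw [← hs]; exact hp s
    · exact ⟨fun _ => 0, fun h' => absurd h' h⟩
  choose γ hγ using this
  let e := Complex.equivRealProdCLM.symm
  refine K5_complex (fun i => e (P i)) (fun i j t => e (γ i j t)) ?_ ?_ ?_ ?_
  · intro i j h
    exact e.continuous.comp (hγ i j h).1
  · intro i j h
    simp [(hγ i j h).2.1]
  · intro i j h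
    simp [(hγ i j h).2.2.1]
  · intro i j k l hij hkl hik hil hjk hjl s t heq
    have := e.injective heq
    exact Set.disjoint_left.1 (hd i j k l hij hkl hik hil hjk hjl) ((hγ i j hij).2.2.2 s)
      (this ▸ (hγ k l hkl).2.2.2 t)

namespace PlaneEmbedding

section topo

variable {V : Type} {G : SimpleGraph V} (E : PlaneEmbedding G)

/-- The drawing of the subgraph induced by `W`. -/
def im (W : Finset V) : Set (ℝ × ℝ) :=
  E.pos '' (W : Set V) ∪ ⋃ e ∈ {e | e ∈ G.edgeSet ∧ ∀ v ∈ e, v ∈ W}, E.arc e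

/-- The face containing `z` of the drawing of the subgraph induced by `W`. -/
def fc (z : ℝ × ℝ) (W : Finset V) : Set (ℝ × ℝ) := connectedComponentIn (E.im W)ᶜ z

/-- Vertices of `W` incident with the face of `z`. -/
def out (z : ℝ × ℝ) (W : Finset V) (v : V) : Prop := v ∈ W ∧ E.pos v ∈ closure (E.fc z W)

variable {E}

theorem oriented {u v : V} (h : G.Adj u v) : ∃ γ : ℝ → ℝ × ℝ,
    ContinuousOn γ (Icc 0 1) ∧ InjOn γ (Icc 0 1) ∧ γ '' (Icc 0 1) = E.arc s(u, v) ∧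
    γ 0 = E.pos u ∧ γ 1 = E.pos v := by
  obtain ⟨γ, hc, hi, him, hend⟩ := E.arc_is_arc s(u, v) h
  have huv : E.pos u ≠ E.pos v := fun h' => h.ne (E.pos_inj h')
  have he := hend u v rfl
  have h0 : γ 0 ∈ ({E.pos u, E.pos v} : Set (ℝ × ℝ)) := he ▸ by simp
  have h1 : γ 1 ∈ ({E.pos u, E.pos v} : Set (ℝ × ℝ)) := he ▸ by simp
  have h01 : γ 0 ≠ γ 1 := fun h' => by
    have := hi (by simp) (by simp) h'
    norm_num at this
  simp only [mem_insert_iff, mem_singleton_iff] at h0 h1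
  rcases h0 with h0 | h0
  · have h1 : γ 1 = E.pos v := h1.resolve_left (fun h' => h01 (h0.trans h'.symm))
    exact ⟨γ, hc, hi, him, h0, h1⟩
  · have h1 : γ 1 = E.pos u := h1.resolve_right (fun h' => h01 (h0.trans h'.symm))
    have hm : MapsTo (fun t : ℝ => 1 - t) (Icc 0 1) (Icc 0 1) := by
      intro t ht; simp only [mem_Icc] at *; constructor <;> linarith
    refine ⟨fun t => γ (1 - t), hc.comp (by fun_prop) hm, ?_, ?_, by simpa using h1,
      by simpa using h0⟩
    · intro s hs t ht hst
      have := hi (hm hs) (hm ht) hst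
      linarith
    · rw [← him]
      ext q
      constructor
      · rintro ⟨t, ht, rfl⟩
        exact ⟨1 - t, hm ht, rfl⟩
      · rintro ⟨t, ht, rfl⟩
        exact ⟨1 - t, hm ht, by simp⟩

theorem isCompact_arc {e : Sym2 V} (h : e ∈ G.edgeSet) : IsCompact (E.arc e) := by
  obtain ⟨γ, hc, -, him, -⟩ := E.arc_is_arc e h
  rw [← him]
  exact isCompact_Icc.image_of_continuousOn hc

theorem joined_arc {u v : V} (h : G.Adj u v) :
    JoinedIn (E.arc s(u, v)) (E.pos u) (E.pos v) := by
  obtain ⟨γ, hc, -, him, h0, h1⟩ := oriented (E := E) h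
  rw [← him]
  exact JoinedIn.ofLine hc h0 h1 subset_rfl

theorem pos_mem_arc {u v : V} (h : G.Adj u v) : E.pos u ∈ E.arc s(u, v) :=
  (joined_arc h).source_mem

theorem isCompact_im [Finite V] (W : Finset V) : IsCompact (E.im W) := by
  refine ((W.finite_toSet.image _).isCompact).union ?_
  refine (Set.toFinite _).isCompact_biUnion ?_
  intro e he
  exact isCompact_arc he.1

theorem im_mono {W W' : Finset V} (h : W' ⊆ W) : E.im W' ⊆ E.im W := by
  apply Set.union_subset_union
  · exact Set.image_mono (by exact_mod_cast h)
  · exact Set.biUnion_subset_biUnion_left (fun e he => ⟨he.1, fun v hv => h (he.2 v hv)⟩)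

theorem arc_subset_im {W : Finset V} {u v : V} (h : G.Adj u v) (hu : u ∈ W) (hv : v ∈ W) :
    E.arc s(u, v) ⊆ E.im W := by
  intro q hq
  refine Or.inr (Set.mem_biUnion (x := s(u, v)) ⟨h, ?_⟩ hq)
  intro w hw
  rcases Sym2.mem_iff.1 hw with rfl | rfl <;> assumption

theorem pos_mem_im {W : Finset V} {v : V} (hv : v ∈ W) : E.pos v ∈ E.im W :=
  Or.inl ⟨v, hv, rfl⟩

theorem pos_notin_im {W : Finset V} {v : V} (hv : v ∉ W) : E.pos v ∉ E.im W := by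
  rintro (⟨u, hu, h⟩ | h)
  · exact hv (E.pos_inj h ▸ hu)
  · simp only [mem_iUnion, mem_ofPred_eq] at h
    obtain ⟨e, ⟨he, hW⟩, hm⟩ := h
    exact hv (hW v (E.arc_inter_pos e he v hm))

theorem arc_inter_im {W : Finset V} {x y : V} (h : G.Adj x y) (hx : x ∉ W) {q : ℝ × ℝ}
    (hq : q ∈ E.arc s(x, y)) (hq' : q ∈ E.im W) : y ∈ W ∧ q = E.pos y := by
  rcases hq' with ⟨u, hu, rfl⟩ | h'
  · have := E.arc_inter_pos _ h u hq
    rcases Sym2.mem_iff.1 this with rfl | rfl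
    · exact absurd hu hx
    · exact ⟨hu, rfl⟩
  · simp only [mem_iUnion, mem_ofPred_eq] at h'
    obtain ⟨e, ⟨he, hW⟩, hm⟩ := h'
    have hne : s(x, y) ≠ e := by
      rintro rfl
      exact hx (hW x (by simp))
    obtain ⟨v, hv1, hv2, rfl⟩ := E.arc_inter_arc _ h e he hne q ⟨hq, hm⟩
    rcases Sym2.mem_iff.1 hv1 with rfl | rfl
    · exact absurd (hW _ hv2) hx
    · exact ⟨hW _ hv2, rfl⟩

theorem fc_mono {z : ℝ × ℝ} {W W' : Finset V} (h : W' ⊆ W) : E.fc z W ⊆ E.fc z W' :=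
  connectedComponentIn_mono z (compl_subset_compl.2 (im_mono h))

theorem fc_disj {z : ℝ × ℝ} {W : Finset V} : Disjoint (E.fc z W) (E.im W) :=
  Set.disjoint_left.2 fun _ hq => connectedComponentIn_subset _ _ hq

theorem isOpen_fc [Finite V] {z : ℝ × ℝ} {W : Finset V} : IsOpen (E.fc z W) :=
  (isCompact_im W).isClosed.isOpen_compl.connectedComponentIn

theorem out_mono {z : ℝ × ℝ} {W W' : Finset V} (h : W' ⊆ W) {v : V} (hv : v ∈ W')
    (ho : E.out z W v) : E.out z W' v :=
  ⟨hv, closure_mono (fc_mono h) ho.2⟩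

theorem out_of_pos_mem {z : ℝ × ℝ} {W : Finset V} {x y : V} (h : G.Adj x y)
    (hx : x ∉ W) (hy : y ∈ W) (hz : E.pos x ∈ E.fc z W) : E.out z W y := by
  refine ⟨hy, ?_⟩
  obtain ⟨γ, hc, hi, him, h0, h1⟩ := oriented (E := E) h
  have hsub : γ '' Ico 0 1 ⊆ E.fc z W := by
    have hz' : E.fc z W = connectedComponentIn (E.im W)ᶜ (E.pos x) := connectedComponentIn_eq hz
    rw [hz']
    apply IsPreconnected.subset_connectedComponentIn
    · exact isPreconnected_Ico.image _ (hc.mono Ico_subset_Icc_self)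
    · exact ⟨0, by simp, h0⟩
    · rintro _ ⟨t, ht, rfl⟩ hq
      have := (arc_inter_im h hx (him ▸ mem_image_of_mem γ (Ico_subset_Icc_self ht)) hq).2
      have := hi (Ico_subset_Icc_self ht) (by simp) (this.trans h1.symm)
      exact ht.2.ne this
  have : E.pos y ∈ γ '' closure (Ico 0 1) := by
    rw [closure_Ico (by norm_num)]
    exact ⟨1, by simp, h1⟩
  have h2 : γ '' closure (Ico 0 1) ⊆ closure (γ '' Ico 0 1) :=
    ContinuousOn.image_closure (by rwa [closure_Ico (by norm_num)])
  exact closure_mono hsub (h2 this)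

theorem out_new {V : Type} {G : SimpleGraph V} {E : PlaneEmbedding G} (x : V) (W : Finset V)
    (hx : x ∉ W) (y : V) (h : G.Adj x y) (hy : y ∈ W) : E.out (E.pos x) W y :=
  out_of_pos_mem h hx hy (mem_connectedComponentIn (pos_notin_im hx))

theorem out_erase [Finite V] [DecidableEq V] {z : ℝ × ℝ} {W : Finset V} {x y : V}
    (h : G.Adj x y) (hx : E.out z W x) (hy : y ∈ W) : E.out z (W.erase x) y := by
  refine out_of_pos_mem h (Finset.notMem_erase _ _) (Finset.mem_erase.2 ⟨h.ne', hy⟩) ?_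
  have hx' : E.pos x ∈ closure (E.fc z (W.erase x)) :=
    closure_mono (fc_mono (Finset.erase_subset _ _)) hx.2
  have hn : E.pos x ∉ E.im (W.erase x) := pos_notin_im (Finset.notMem_erase _ _)
  have ho : IsOpen (connectedComponentIn (E.im (W.erase x))ᶜ (E.pos x)) :=
    (isCompact_im _).isClosed.isOpen_compl.connectedComponentIn
  obtain ⟨q, hq1, hq2⟩ := mem_closure_iff.1 hx' _ ho (mem_connectedComponentIn hn)
  have e1 := connectedComponentIn_eq hq1
  have e2 : E.fc z (W.erase x) = _ := connectedComponentIn_eq hq2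
  rw [e2, ← e1]
  exact mem_connectedComponentIn hn

theorem out_joined [Finite V] [DecidableEq V] {z : ℝ × ℝ} {W : Finset V} {x : V}
    (hx : E.out z W x) : ∃ K : Set (ℝ × ℝ), JoinedIn K (E.pos x) z ∧
      Disjoint K (E.im (W.erase x)) := by
  have hn : E.pos x ∉ E.im (W.erase x) := pos_notin_im (Finset.notMem_erase _ _)
  obtain ⟨r, hr, hb⟩ := Metric.isOpen_iff.1
    (isCompact_im (E := E) (W.erase x)).isClosed.isOpen_compl _ hn
  obtain ⟨q, hq1, hq2⟩ := mem_closure_iff.1 hx.2 _ Metric.isOpen_ball (Metric.mem_ball_self hr)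
  refine ⟨Metric.ball (E.pos x) r ∪ E.fc z W, ?_, ?_⟩
  · have j1 : JoinedIn (Metric.ball (E.pos x) r) (E.pos x) q :=
      ((convex_ball _ r).isPathConnected ⟨_, Metric.mem_ball_self hr⟩).joinedIn _
        (Metric.mem_ball_self hr) _ hq1
    have hz : z ∈ (E.im W)ᶜ := by
      by_contra h
      have : E.fc z W = ∅ := connectedComponentIn_eq_empty h
      rw [this] at hq2
      exact hq2
    have hpc : IsPathConnected (E.fc z W) :=
      (isOpen_fc.isConnected_iff_isPathConnected).1 (isConnected_connectedComponentIn_iff.2 hz)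
    have j2 : JoinedIn (E.fc z W) q z := hpc.joinedIn _ hq2 _ (mem_connectedComponentIn hz)
    exact (j1.mono subset_union_left).trans (j2.mono subset_union_right)
  · apply Disjoint.union_left
    · exact Set.disjoint_left.2 fun q hq => hb hq
    · exact fc_disj.mono_right (im_mono (Finset.erase_subset _ _))

theorem arc_disj_im {W : Finset V} {x y : V} (h : G.Adj x y) (hx : x ∉ W) (hy : y ∉ W) :
    Disjoint (E.arc s(x, y)) (E.im W) :=
  Set.disjoint_left.2 fun _ hq hqW => hy (arc_inter_im h hx hq hqW).1

/-- If `b` and `c` are separated in the subgraph induced by `W`. -/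
def Sep (G : SimpleGraph V) (W : Finset V) (b c : V) : Prop :=
  ∃ C ⊆ W, b ∈ C ∧ c ∉ C ∧ ∀ u ∈ C, ∀ v ∈ W, G.Adj u v → v ∈ C

theorem joined_im {W : Finset V} {b c : V} (hb : b ∈ W) (hc : c ∈ W) (h : ¬ Sep G W b c) :
    JoinedIn (E.im W) (E.pos b) (E.pos c) := by
  classical
  by_contra hn
  refine h ⟨W.filter (fun v => JoinedIn (E.im W) (E.pos b) (E.pos v)), Finset.filter_subset _ _,
    ?_, ?_, ?_⟩
  · exact Finset.mem_filter.2 ⟨hb, JoinedIn.refl (pos_mem_im hb)⟩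
  · exact fun h => hn (Finset.mem_filter.1 h).2
  · intro u hu v hv huv
    have hu := Finset.mem_filter.1 hu
    exact Finset.mem_filter.2 ⟨hv, hu.2.trans ((joined_arc huv).mono (arc_subset_im huv hu.1 hv))⟩

/-- The key separation property. -/
theorem key [Finite V] [DecidableEq V] {z : ℝ × ℝ} {W : Finset V} {x a b c : V}
    (hx : E.out z W x) (ha : E.out z W a) (hb : E.out z W b) (hc : E.out z W c)
    (hxa : G.Adj x a) (hxb : G.Adj x b) (hxc : G.Adj x c) (hab : a ≠ b) (hac : a ≠ c)
    (hbc : b ≠ c) :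
    Sep G ((W.erase x).erase a) b c ∨ Sep G ((W.erase x).erase b) a c ∨
      Sep G ((W.erase x).erase c) a b := by
  by_contra! hcon
  obtain ⟨h1, h2, h3⟩ := hcon
  have jbc := joined_im (E := E) (by simp [hb.1, hxb.ne', hab.symm])
    (by simp [hc.1, hxc.ne', hac.symm]) h1
  have jac := joined_im (E := E) (by simp [ha.1, hxa.ne', hab])
    (by simp [hc.1, hxc.ne', hbc.symm]) h2
  have jab := joined_im (E := E) (by simp [ha.1, hxa.ne', hac])
    (by simp [hb.1, hxb.ne', hbc]) h3
  obtain ⟨Kx, jx, dx⟩ := out_joined hx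
  obtain ⟨Ka, ja, da⟩ := out_joined ha
  obtain ⟨Kb, jb, db⟩ := out_joined hb
  obtain ⟨Kc, jc, dc⟩ := out_joined hc
  -- disjointness facts
  have sub1 : ∀ u v : V, (W.erase u).erase v ⊆ W.erase u := fun u v => Finset.erase_subset _ _
  have sub2 : ∀ u v : V, (W.erase u).erase v ⊆ W.erase v := fun u v =>
    Finset.erase_subset_erase _ (Finset.erase_subset _ _)
  have dxbc := dx.mono_right (im_mono (E := E) (sub1 x a))
  have dxac := dx.mono_right (im_mono (E := E) (sub1 x b))
  have dxab := dx.mono_right (im_mono (E := E) (sub1 x c))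
  have dabc := da.mono_right (im_mono (E := E) (sub2 x a))
  have dbac := db.mono_right (im_mono (E := E) (sub2 x b))
  have dcab := dc.mono_right (im_mono (E := E) (sub2 x c))
  have m : ∀ u v : V, G.Adj x u → u ≠ v → x ≠ v → u ∈ W → E.arc s(x, u) ⊆ E.im (W.erase v) :=
    fun u v h huv hxv hu => arc_subset_im h (by simp [hx.1, hxv]) (by simp [hu, huv])
  have daxb := da.mono_right (m b a hxb hab.symm hxa.ne hb.1)
  have daxc := da.mono_right (m c a hxc hac.symm hxa.ne hc.1)
  have dbxa := db.mono_right (m a b hxa hab hxb.ne ha.1)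
  have dbxc := db.mono_right (m c b hxc hbc.symm hxb.ne hc.1)
  have dcxa := dc.mono_right (m a c hxa hac hxc.ne ha.1)
  have dcxb := dc.mono_right (m b c hxb hbc hxc.ne hb.1)
  have ea := arc_disj_im (E := E) (W := (W.erase x).erase a) hxa (by simp) (by simp)
  have eb := arc_disj_im (E := E) (W := (W.erase x).erase b) hxb (by simp) (by simp)
  have ec := arc_disj_im (E := E) (W := (W.erase x).erase c) hxc (by simp) (by simp)
  let P : Fin 5 → ℝ × ℝ := ![E.pos x, E.pos a, E.pos b, E.pos c, z]
  let K : Fin 5 → Fin 5 → Set (ℝ × ℝ) :=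
    ![![∅, E.arc s(x, a), E.arc s(x, b), E.arc s(x, c), Kx],
      ![∅, ∅, E.im ((W.erase x).erase c), E.im ((W.erase x).erase b), Ka],
      ![∅, ∅, ∅, E.im ((W.erase x).erase a), Kb],
      ![∅, ∅, ∅, ∅, Kc],
      ![∅, ∅, ∅, ∅, ∅]]
  refine K5_plane P K ?_ ?_
  · intro i j hij
    have jxa := joined_arc (E := E) hxa
    have jxb := joined_arc (E := E) hxb
    have jxc := joined_arc (E := E) hxc
    fin_cases i <;> fin_cases j <;> first | exact absurd hij (by decide) | assumption
  · intro i j k l hij hkl hik hil hjk hjl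
    fin_cases i <;> fin_cases j <;> first | exact absurd hij (by decide) | skip
    all_goals
      fin_cases k <;> first | exact absurd rfl hik | exact absurd rfl hjk | skip
    all_goals
      fin_cases l <;> first | exact absurd hkl (by decide) | exact absurd rfl hil |
        exact absurd rfl hjl | assumption | (apply Disjoint.symm; assumption)

end topo

end PlaneEmbedding

namespace PlaneEmbedding

section comb

variable {V : Type} {G : SimpleGraph V}

/-- `φ` is a proper `L`-coloring of the subgraph induced by `W`. -/
def Col (G : SimpleGraph V) (W : Finset V) (L : V → Finset ℕ) (φ : V → ℕ) : Prop :=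
  (∀ v ∈ W, φ v ∈ L v) ∧ ∀ u ∈ W, ∀ v ∈ W, G.Adj u v → φ u ≠ φ v

/-- Colorability with nothing precolored. -/
def S0 (E : PlaneEmbedding G) (W : Finset V) : Prop :=
  ∀ (z : ℝ × ℝ) (L : V → Finset ℕ),
    (∀ v ∈ W, 3 ≤ (L v).card ∧ (¬ E.out z W v → 5 ≤ (L v).card)) → ∃ φ, Col G W L φ

/-- Colorability with one vertex precolored. -/
def S1 (E : PlaneEmbedding G) (W : Finset V) : Prop :=
  ∀ (z : ℝ × ℝ) (L : V → Finset ℕ) (p : V) (c : ℕ), E.out z W p → c ∈ L p →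
    (∀ v ∈ W, v ≠ p → 3 ≤ (L v).card ∧ (¬ E.out z W v → 5 ≤ (L v).card)) →
    ∃ φ, Col G W L φ ∧ φ p = c

/-- Colorability with two adjacent vertices precolored. -/
def S2 (E : PlaneEmbedding G) (W : Finset V) : Prop :=
  ∀ (z : ℝ × ℝ) (L : V → Finset ℕ) (p q : V) (c d : ℕ), E.out z W p → E.out z W q →
    G.Adj p q → c ∈ L p → d ∈ L q → c ≠ d →
    (∀ v ∈ W, v ≠ p → v ≠ q → 3 ≤ (L v).card ∧ (¬ E.out z W v → 5 ≤ (L v).card)) →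
    ∃ φ, Col G W L φ ∧ φ p = c ∧ φ q = d

open Classical in
/-- The lists after deleting `x` and reserving the colors `T` for it. -/
noncomputable def red (E : PlaneEmbedding G) (z : ℝ × ℝ) (W : Finset V) (x : V) (T : Finset ℕ)
    (L : V → Finset ℕ) (v : V) : Finset ℕ :=
  if G.Adj x v ∧ ¬ E.out z W v then L v \ T else L v

theorem red_sub {E : PlaneEmbedding G} {z : ℝ × ℝ} {W : Finset V} {x : V} {T : Finset ℕ}
    {L : V → Finset ℕ} (v : V) : red E z W x T L v ⊆ L v := by
  unfold red
  split_ifs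
  · exact Finset.sdiff_subset
  · exact subset_rfl

theorem red_out {E : PlaneEmbedding G} {z : ℝ × ℝ} {W : Finset V} {x : V} {T : Finset ℕ}
    {L : V → Finset ℕ} {v : V} (h : E.out z W v) : red E z W x T L v = L v := by
  unfold red
  rw [if_neg]
  exact fun h' => h'.2 h

theorem red_adj {E : PlaneEmbedding G} {z : ℝ × ℝ} {W : Finset V} {x : V} {T : Finset ℕ}
    {L : V → Finset ℕ} {v : V} (h : ¬ E.out z W v) (ha : G.Adj x v) {a : ℕ}
    (h' : a ∈ red E z W x T L v) : a ∉ T := by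
  unfold red at h'
  rw [if_pos ⟨ha, h⟩] at h'
  exact (Finset.mem_sdiff.1 h').2

variable [DecidableEq V]

theorem red_card {E : PlaneEmbedding G} {z z' : ℝ × ℝ} {W : Finset V} {x : V} {T : Finset ℕ}
    {L : V → Finset ℕ} {v : V} (hT : T.card ≤ 2) (hv : v ∈ W.erase x)
    (h1 : G.Adj x v → E.out z' (W.erase x) v)
    (h2 : E.out z W v → E.out z' (W.erase x) v)
    (h : 3 ≤ (L v).card ∧ (¬ E.out z W v → 5 ≤ (L v).card)) :
    3 ≤ (red E z W x T L v).card ∧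
      (¬ E.out z' (W.erase x) v → 5 ≤ (red E z W x T L v).card) := by
  unfold red
  split_ifs with hc
  · refine ⟨?_, fun h' => absurd (h1 hc.1) h'⟩
    have := h.2 hc.2
    have := Finset.le_card_sdiff T (L v)
    omega
  · exact ⟨h.1, fun h' => h.2 (fun ho => h' (h2 ho))⟩

theorem red_card' [Finite V] {E : PlaneEmbedding G} {z : ℝ × ℝ} {W : Finset V} {x : V}
    {T : Finset ℕ} {L : V → Finset ℕ} {v : V} (hT : T.card ≤ 2) (hx : E.out z W x)
    (hv : v ∈ W.erase x)
    (h : 3 ≤ (L v).card ∧ (¬ E.out z W v → 5 ≤ (L v).card)) :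
    3 ≤ (red E z W x T L v).card ∧
      (¬ E.out z (W.erase x) v → 5 ≤ (red E z W x T L v).card) :=
  red_card hT hv (fun ha => out_erase ha hx (Finset.mem_of_mem_erase hv))
    (fun ho => out_mono (Finset.erase_subset _ _) hv ho) h

theorem extend {W : Finset V} {x : V} {L L' : V → Finset ℕ} {φ : V → ℕ}
    (h : Col G (W.erase x) L' φ) (hL : ∀ v, L' v ⊆ L v) {a : ℕ} (ha : a ∈ L x)
    (hn : ∀ y ∈ W.erase x, G.Adj x y → φ y ≠ a) :
    Col G W L (Function.update φ x a) := by
  constructor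
  · intro v hv
    by_cases hvx : v = x
    · subst hvx; simpa using ha
    · rw [Function.update_of_ne hvx]
      exact hL v (h.1 v (Finset.mem_erase.2 ⟨hvx, hv⟩))
  · intro u hu v hv huv
    by_cases hux : u = x
    · subst hux
      rw [Function.update_self, Function.update_of_ne huv.ne']
      exact (hn v (Finset.mem_erase.2 ⟨huv.ne', hv⟩) huv).symm
    · rw [Function.update_of_ne hux]
      by_cases hvx : v = x
      · subst hvx
        rw [Function.update_self]
        exact hn u (Finset.mem_erase.2 ⟨hux, hu⟩) huv.symm
      · rw [Function.update_of_ne hvx]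
        exact h.2 u (Finset.mem_erase.2 ⟨hux, hu⟩) v (Finset.mem_erase.2 ⟨hvx, hv⟩) huv

theorem s0_of {E : PlaneEmbedding G} {W : Finset V} (ih : ∀ W' ⊂ W, S0 E W') (h1 : S1 E W) :
    S0 E W := by
  intro z L hL
  by_cases hv : ∃ v, E.out z W v
  · obtain ⟨v, hv⟩ := hv
    have h3 := (hL v hv.1).1
    obtain ⟨c, hc⟩ : (L v).Nonempty := Finset.card_pos.1 (by omega)
    obtain ⟨φ, hφ, -⟩ := h1 z L v c hv hc (fun u hu _ => hL u hu)
    exact ⟨φ, hφ⟩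
  · push Not at hv
    rcases W.eq_empty_or_nonempty with rfl | ⟨x, hx⟩
    · exact ⟨fun _ => 0, by simp [Col]⟩
    · have h3 := (hL x hx).1
      obtain ⟨c, hc⟩ : (L x).Nonempty := Finset.card_pos.1 (by omega)
      obtain ⟨φ, hφ⟩ := ih _ (Finset.erase_ssubset hx) (E.pos x) (red E z W x {c} L) (by
        intro v hvW
        exact red_card (by simp) hvW (fun ha => out_new x _ (Finset.notMem_erase _ _) v ha hvW)
          (fun ho => absurd ho (hv v)) (hL v (Finset.mem_of_mem_erase hvW)))
      refine ⟨_, extend hφ red_sub hc ?_⟩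
      intro y hy ha
      have := red_adj (hv y) ha (hφ.1 y hy)
      simpa using this

theorem s1_of [Finite V] {E : PlaneEmbedding G} {W : Finset V} (ih : ∀ W' ⊂ W, S0 E W')
    (h2 : S2 E W) : S1 E W := by
  intro z L p c hp hc hL
  by_cases hq : ∃ q, E.out z W q ∧ G.Adj p q
  · obtain ⟨q, hq, hpq⟩ := hq
    have h3 := (hL q hq.1 hpq.ne').1
    obtain ⟨d, hd, hdc⟩ : ∃ d ∈ L q, d ≠ c := Finset.exists_mem_ne (by omega) c
    obtain ⟨φ, hφ, h, -⟩ := h2 z L p q c d hp hq hpq hc hd hdc.symm (fun u hu h _ => hL u hu h)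
    exact ⟨φ, hφ, h⟩
  · push Not at hq
    obtain ⟨φ, hφ⟩ := ih _ (Finset.erase_ssubset hp.1) z (red E z W p {c} L) (by
      intro v hv
      exact red_card' (by simp) hp hv
        (hL v (Finset.mem_of_mem_erase hv) (Finset.ne_of_mem_erase hv)))
    refine ⟨_, extend hφ red_sub hc ?_, by simp⟩
    intro y hy ha
    have := red_adj (fun ho => hq y ho ha) ha (hφ.1 y hy)
    simpa using this

/-- Gluing colorings along a chord. -/
theorem glue {E : PlaneEmbedding G} {W A B : Finset V} (hA : A ⊂ W) (hB : B ⊂ W)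
    (ih : ∀ W' ⊂ W, S2 E W') {z : ℝ × ℝ} {L : V → Finset ℕ} {p q : V} {c d : ℕ}
    (hp : E.out z W p) (hq : E.out z W q) (hpq : G.Adj p q) (hc : c ∈ L p) (hd : d ∈ L q)
    (hcd : c ≠ d)
    (hL : ∀ v ∈ W, v ≠ p → v ≠ q → 3 ≤ (L v).card ∧ (¬ E.out z W v → 5 ≤ (L v).card))
    {u v : V} (hu : E.out z W u) (hv : E.out z W v) (huv : G.Adj u v)
    (hpA : p ∈ A) (hqA : q ∈ A) (huA : u ∈ A) (hvA : v ∈ A) (huB : u ∈ B) (hvB : v ∈ B)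
    (hU : ∀ w ∈ W, w ∈ A ∨ w ∈ B) (hI : ∀ w ∈ A, w ∈ B → w = u ∨ w = v)
    (hE : ∀ s ∈ A, ∀ t ∈ B, G.Adj s t → t ∈ A ∨ s ∈ B) :
    ∃ φ, Col G W L φ ∧ φ p = c ∧ φ q = d := by
  obtain ⟨φ, hφ, hφp, hφq⟩ := ih A hA z L p q c d (out_mono hA.subset hpA hp)
    (out_mono hA.subset hqA hq) hpq hc hd hcd (by
      intro w hw h1 h2
      obtain ⟨h3, h5⟩ := hL w (hA.subset hw) h1 h2
      exact ⟨h3, fun h => h5 (fun ho => h (out_mono hA.subset hw ho))⟩)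
  obtain ⟨ψ, hψ, hψu, hψv⟩ := ih B hB z L u v (φ u) (φ v) (out_mono hB.subset huB hu)
    (out_mono hB.subset hvB hv) huv (hφ.1 u huA) (hφ.1 v hvA) (hφ.2 u huA v hvA huv) (by
      intro w hw h1 h2
      have hwA : w ∉ A := fun h => by
        rcases hI w h hw with h | h
        · exact h1 h
        · exact h2 h
      obtain ⟨h3, h5⟩ := hL w (hB.subset hw) (fun h => hwA (h ▸ hpA)) (fun h => hwA (h ▸ hqA))
      exact ⟨h3, fun h => h5 (fun ho => h (out_mono hB.subset hw ho))⟩)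
  have hag : ∀ w ∈ A, w ∈ B → φ w = ψ w := by
    intro w hw hw'
    rcases hI w hw hw' with rfl | rfl
    · exact hψu.symm
    · exact hψv.symm
  let χ : V → ℕ := fun w => if w ∈ A then φ w else ψ w
  have hχA : ∀ w ∈ A, χ w = φ w := fun w hw => if_pos hw
  have hχB : ∀ w ∈ B, χ w = ψ w := by
    intro w hw
    by_cases h : w ∈ A
    · rw [hχA w h, hag w h hw]
    · exact if_neg h
  have hAA : ∀ s ∈ A, ∀ t ∈ A, G.Adj s t → χ s ≠ χ t := by
    intro s hs t ht hst
    rw [hχA s hs, hχA t ht]; exact hφ.2 s hs t ht hst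
  have hBB : ∀ s ∈ B, ∀ t ∈ B, G.Adj s t → χ s ≠ χ t := by
    intro s hs t ht hst
    rw [hχB s hs, hχB t ht]; exact hψ.2 s hs t ht hst
  have hAB : ∀ s ∈ A, ∀ t ∈ B, G.Adj s t → χ s ≠ χ t := by
    intro s hs t ht hst
    rcases hE s hs t ht hst with h | h
    · exact hAA s hs t h hst
    · exact hBB s h t ht hst
  refine ⟨χ, ⟨?_, ?_⟩, by rw [hχA p hpA, hφp], by rw [hχA q hqA, hφq]⟩
  · intro w hw
    rcases hU w hw with h | h
    · rw [hχA w h]; exact hφ.1 w h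
    · rw [hχB w h]; exact hψ.1 w h
  · intro s hs t ht hst
    rcases hU s hs with h | h <;> rcases hU t ht with h' | h'
    · exact hAA s h t h' hst
    · exact hAB s h t h' hst
    · exact (hAB t h' s h hst.symm).symm
    · exact hBB s h t h' hst

theorem glue_sep {E : PlaneEmbedding G} {W : Finset V}
    (ih : ∀ W' ⊂ W, S2 E W') {z : ℝ × ℝ} {L : V → Finset ℕ} {p q : V} {c d : ℕ}
    (hp : E.out z W p) (hq : E.out z W q) (hpq : G.Adj p q) (hc : c ∈ L p) (hd : d ∈ L q)
    (hcd : c ≠ d)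
    (hL : ∀ v ∈ W, v ≠ p → v ≠ q → 3 ≤ (L v).card ∧ (¬ E.out z W v → 5 ≤ (L v).card))
    {u v : V} (hu : E.out z W u) (hv : E.out z W v) (huv : G.Adj u v) {s t : V}
    (ht : t ∈ (W.erase u).erase v)
    (hs : Sep G ((W.erase u).erase v) s t) :
    ∃ φ, Col G W L φ ∧ φ p = c ∧ φ q = d := by
  obtain ⟨C, hCW, hsC, htC, hcl⟩ := hs
  have hC : ∀ w ∈ C, w ∈ W ∧ w ≠ u ∧ w ≠ v := by
    intro w hw
    have := hCW hw
    simp only [Finset.mem_erase] at this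
    tauto
  simp only [Finset.mem_erase] at ht
  have hA : insert u (insert v C) ⊂ W := by
    refine Finset.ssubset_iff_subset_ne.2 ⟨?_, ?_⟩
    · intro w hw
      simp only [Finset.mem_insert] at hw
      rcases hw with rfl | rfl | hw
      · exact hu.1
      · exact hv.1
      · exact (hC w hw).1
    · intro h
      have := h ▸ ht.2.2
      simp only [Finset.mem_insert] at this
      tauto
  have hB : W \ C ⊂ W := by
    refine Finset.ssubset_iff_subset_ne.2 ⟨Finset.sdiff_subset, ?_⟩
    intro h
    have : s ∈ W \ C := by rw [h]; exact (hC s hsC).1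
    exact (Finset.mem_sdiff.1 this).2 hsC
  have huC : u ∉ C := fun h => (hC u h).2.1 rfl
  have hvC : v ∉ C := fun h => (hC v h).2.2 rfl
  have hcl' : ∀ a ∈ C, ∀ b ∈ W, G.Adj a b → b = u ∨ b = v ∨ b ∈ C := by
    intro a ha b hb hab
    by_cases h1 : b = u
    · exact Or.inl h1
    by_cases h2 : b = v
    · exact Or.inr (Or.inl h2)
    · exact Or.inr (Or.inr (hcl a ha b (by simp [h1, h2, hb]) hab))
  have huB : u ∈ W \ C := Finset.mem_sdiff.2 ⟨hu.1, huC⟩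
  have hvB : v ∈ W \ C := Finset.mem_sdiff.2 ⟨hv.1, hvC⟩
  have huA : u ∈ insert u (insert v C) := by simp
  have hvA : v ∈ insert u (insert v C) := by simp
  have hU : ∀ w ∈ W, w ∈ insert u (insert v C) ∨ w ∈ W \ C := by
    intro w hw
    by_cases h : w ∈ C
    · left; simp [h]
    · right; simp [h, hw]
  have hI : ∀ w ∈ insert u (insert v C), w ∈ W \ C → w = u ∨ w = v := by
    intro w hw hw'
    simp only [Finset.mem_insert, Finset.mem_sdiff] at hw hw'
    tauto
  have hE : ∀ a ∈ insert u (insert v C), ∀ b ∈ W \ C, G.Adj a b →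
      b ∈ insert u (insert v C) ∨ a ∈ W \ C := by
    intro a ha b hb hab
    simp only [Finset.mem_insert] at ha ⊢
    rcases ha with rfl | rfl | ha
    · right; exact huB
    · right; exact hvB
    · left; exact hcl' a ha b (Finset.mem_sdiff.1 hb).1 hab
  by_cases hside : p ∈ insert u (insert v C) ∧ q ∈ insert u (insert v C)
  · exact glue hA hB ih hp hq hpq hc hd hcd hL hu hv huv hside.1 hside.2 huA hvA huB hvB hU hI hE
  · have hside' : p ∈ W \ C ∧ q ∈ W \ C := by
      have h1 : p ∈ C → q = u ∨ q = v ∨ q ∈ C := fun h => hcl' p h q hq.1 hpq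
      have h2 : q ∈ C → p = u ∨ p = v ∨ p ∈ C := fun h => hcl' q h p hp.1 hpq.symm
      have h3 := hp.1
      have h4 := hq.1
      simp only [Finset.mem_insert, Finset.mem_sdiff] at hside ⊢
      tauto
    exact glue hB hA ih hp hq hpq hc hd hcd hL hu hv huv hside'.1 hside'.2 huB hvB huA hvA
      (fun w hw => (hU w hw).symm) (fun w h h' => hI w h' h)
      (fun a ha b hb hab => (hE b hb a ha hab.symm).symm)

theorem s2_of [Finite V] {E : PlaneEmbedding G} {W : Finset V}
    (ih1 : ∀ W' ⊂ W, S1 E W') (ih2 : ∀ W' ⊂ W, S2 E W') : S2 E W := by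
  intro z L p q c d hp hq hpq hc hd hcd hL
  by_cases hx : ∃ x, E.out z W x ∧ G.Adj p x ∧ x ≠ q
  · obtain ⟨x, hx, hpx, hxq⟩ := hx
    by_cases hbc : ∃ a b, a ≠ b ∧ a ≠ p ∧ b ≠ p ∧ G.Adj x a ∧ G.Adj x b ∧
        E.out z W a ∧ E.out z W b
    · obtain ⟨a, b, hab, hap, hbp, hxa, hxb, ha, hb⟩ := hbc
      have e1 := hxa.ne'
      have e2 := hxb.ne'
      have e3 := hpx.ne
      rcases key hx hp ha hb hpx.symm hxa hxb hap.symm hbp.symm hab with h | h | h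
      · exact glue_sep ih2 hp hq hpq hc hd hcd hL hx hp hpx.symm
          (by simp [hb.1, hbp, e2]) h
      · exact glue_sep ih2 hp hq hpq hc hd hcd hL hx ha hxa
          (by simp [hb.1, hab.symm, e2]) h
      · exact glue_sep ih2 hp hq hpq hc hd hcd hL hx hb hxb
          (by simp [ha.1, hab, e1]) h
    · have huniq : ∀ a b, a ≠ p → b ≠ p → G.Adj x a → G.Adj x b → E.out z W a → E.out z W b →
          a = b := by
        intro a b h1 h2 h3 h4 h5 h6
        by_contra h
        exact hbc ⟨a, b, h, h1, h2, h3, h4, h5, h6⟩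
      have h3 := (hL x hx.1 hpx.ne' hxq).1
      obtain ⟨T, hTs, hT⟩ : ∃ T ⊆ (L x).erase c, T.card = 2 :=
        Finset.exists_subset_card_eq (by
          have := Finset.pred_card_le_card_erase (s := L x) (a := c)
          omega)
      have hpW : p ∈ W.erase x := Finset.mem_erase.2 ⟨hpx.ne, hp.1⟩
      have hqW : q ∈ W.erase x := Finset.mem_erase.2 ⟨hxq.symm, hq.1⟩
      obtain ⟨φ, hφ, hφp, hφq⟩ := ih2 _ (Finset.erase_ssubset hx.1) z (red E z W x T L) p q c d
        (out_mono (Finset.erase_subset _ _) hpW hp)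
        (out_mono (Finset.erase_subset _ _) hqW hq) hpq
        (by rwa [red_out hp]) (by rwa [red_out hq]) hcd (by
          intro v hv h1 h2
          exact red_card' hT.le hx hv (hL v (Finset.mem_of_mem_erase hv) h1 h2))
      obtain ⟨a, haT, ha⟩ : ∃ a ∈ T, ∀ y, y ≠ p → G.Adj x y → E.out z W y → φ y ≠ a := by
        by_cases hy : ∃ y, y ≠ p ∧ G.Adj x y ∧ E.out z W y
        · obtain ⟨y, h1, h2, h3⟩ := hy
          obtain ⟨a, haT, ha⟩ := Finset.exists_mem_ne (by omega : 1 < T.card) (φ y)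
          refine ⟨a, haT, fun y' h1' h2' h3' => ?_⟩
          rw [huniq y' y h1' h1 h2' h2 h3' h3]
          exact ha.symm
        · obtain ⟨a, haT⟩ := Finset.card_pos.1 (by omega : 0 < T.card)
          exact ⟨a, haT, fun y h1 h2 h3 => absurd ⟨y, h1, h2, h3⟩ hy⟩
      have haL := Finset.mem_erase.1 (hTs haT)
      refine ⟨_, extend hφ red_sub haL.2 ?_, ?_, ?_⟩
      · intro y hy hxy
        by_cases hyp : y = p
        · rw [hyp, hφp]; exact haL.1.symm
        · by_cases hyo : E.out z W y
          · exact ha y hyp hxy hyo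
          · intro h
            exact red_adj hyo hxy (hφ.1 y hy) (h ▸ haT)
      · rw [Function.update_of_ne hpx.ne, hφp]
      · rw [Function.update_of_ne hxq.symm, hφq]
  · have hqW : q ∈ W.erase p := Finset.mem_erase.2 ⟨hpq.ne', hq.1⟩
    obtain ⟨φ, hφ, hφq⟩ := ih1 _ (Finset.erase_ssubset hp.1) z (red E z W p {c} L) q d
      (out_mono (Finset.erase_subset _ _) hqW hq) (by rwa [red_out hq]) (by
        intro v hv h2
        exact red_card' (by simp) hp hv
          (hL v (Finset.mem_of_mem_erase hv) (Finset.ne_of_mem_erase hv) h2))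
    refine ⟨_, extend hφ red_sub hc ?_, by simp, ?_⟩
    · intro y hy hpy
      by_cases hyq : y = q
      · rw [hyq, hφq]; exact hcd.symm
      · have := red_adj (fun ho => hx ⟨y, ho, hpy, hyq⟩) hpy (hφ.1 y hy)
        simpa using this
    · rw [Function.update_of_ne hpq.ne', hφq]

theorem all_of [Finite V] (E : PlaneEmbedding G) (W : Finset V) :
    S0 E W ∧ S1 E W ∧ S2 E W := by
  induction W using Finset.strongInduction with
  | H W ih =>
    have h2 : S2 E W := s2_of (fun W' h => (ih W' h).2.1) (fun W' h => (ih W' h).2.2)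
    have h1 : S1 E W := s1_of (fun W' h => (ih W' h).1) h2
    exact ⟨s0_of (fun W' h => (ih W' h).1) h1, h1, h2⟩

end comb

theorem isPreconnected_far (R : ℝ) (hR : 0 < R) : IsPreconnected {q : ℝ × ℝ | R < ‖q‖} := by
  have h1 : 1 < Module.rank ℝ (ℝ × ℝ) := by
    rw [rank_prod', Module.rank_self, one_add_one_eq_two]
    exact Cardinal.one_lt_two
  have h := ((isPreconnected_sphere h1 (0 : ℝ × ℝ) 1).prod (isPreconnected_Ioi (a := R))).image
    (fun p => p.2 • p.1) (by fun_prop)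
  convert h using 1
  ext q
  simp only [mem_ofPred_eq, mem_image, mem_prod, mem_sphere_zero_iff_norm, mem_Ioi]
  constructor
  · intro hq
    have hq0 : ‖q‖ ≠ 0 := by linarith
    refine ⟨(‖q‖⁻¹ • q, ‖q‖), ⟨?_, hq⟩, ?_⟩
    · simp only [norm_smul, norm_inv, norm_norm]
      field_simp
    · simp [smul_smul, hq0]
  · rintro ⟨⟨y, t⟩, ⟨h1, h2⟩, rfl⟩
    simp only at h1 h2 ⊢
    rw [norm_smul, h1, mul_one]
    exact lt_of_lt_of_le h2 (le_abs_self t)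

theorem exists_far {V : Type} [Fintype V] {G : SimpleGraph V} (E : PlaneEmbedding G) :
    ∃ z, E.outerFace ⊆ E.fc z Finset.univ := by
  have him : E.image = E.im Finset.univ := by
    simp [image, im, Set.image_univ]
  obtain ⟨R, hR⟩ := (isCompact_im (E := E) Finset.univ).isBounded.exists_norm_le
  set R' := max R 1 with hR'
  have hpos : 0 < R' := lt_of_lt_of_le one_pos (le_max_right _ _)
  have hfar : {q : ℝ × ℝ | R' < ‖q‖} ⊆ (E.im Finset.univ)ᶜ := by
    intro q hq hq'
    have h1 := hR q hq'
    have h2 : R ≤ R' := le_max_left _ _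
    have h3 : R' < ‖q‖ := hq
    linarith
  refine ⟨(R' + 1, 0), ?_⟩
  have hz : ((R' + 1, 0) : ℝ × ℝ) ∈ {q : ℝ × ℝ | R' < ‖q‖} := by
    simp only [mem_ofPred_eq, Prod.norm_def]
    refine lt_of_lt_of_le ?_ (le_max_left _ _)
    exact lt_of_lt_of_le (by linarith) (le_abs_self _)
  rintro x ⟨hx, hub⟩
  rw [him] at hx hub
  obtain ⟨q, hq, hqR⟩ : ∃ q ∈ connectedComponentIn (E.im Finset.univ)ᶜ x, R' < ‖q‖ := by
    by_contra! hcon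
    exact hub (isBounded_iff_forall_norm_le.2 ⟨R', hcon⟩)
  have hq2 : q ∈ E.fc (R' + 1, 0) Finset.univ :=
    (isPreconnected_far R' hpos).subset_connectedComponentIn hz hfar hqR
  have e1 := connectedComponentIn_eq hq
  have e2 : E.fc (R' + 1, 0) Finset.univ = _ := connectedComponentIn_eq hq2
  rw [e2, ← e1]
  exact mem_connectedComponentIn hx

end PlaneEmbedding

/-- a canvas whose precolored subgraph is a path of length one is
colorable. -/
theorem canvas_path_length_one {V : Type} [Fintype V] (G : SimpleGraph V)
    (E : PlaneEmbedding G) (S : SimpleGraph.Subgraph G) (L : V → Finset ℕ)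
    (hcv : IsCanvas G E S L)
    (p₁ p₂ : V) (hne : p₁ ≠ p₂) (hverts : S.verts = {p₁, p₂}) (hadj : S.Adj p₁ p₂) :
    ∃ φ : V → ℕ, IsLColoring G L φ := by
  classical
  obtain ⟨-, hSv, -, h5, h3, φ₀, hφ₀, hφ₀'⟩ := hcv
  obtain ⟨z, hz⟩ := E.exists_far
  have hout : ∀ v, E.IncOuter v → E.out z Finset.univ v := fun v hv =>
    ⟨Finset.mem_univ v, closure_mono hz hv⟩
  have hm₁ : p₁ ∈ S.verts := by rw [hverts]; simp
  have hm₂ : p₂ ∈ S.verts := by rw [hverts]; simp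
  obtain ⟨φ, hφ, -, -⟩ := (PlaneEmbedding.all_of E Finset.univ).2.2 z L p₁ p₂ (φ₀ p₁) (φ₀ p₂)
    (hout p₁ (frontier_subset_closure (hSv p₁ hm₁)))
    (hout p₂ (frontier_subset_closure (hSv p₂ hm₂))) (S.adj_sub hadj) (hφ₀ p₁ hm₁) (hφ₀ p₂ hm₂)
    (hφ₀' hadj) (by
      intro v _ h1 h2
      refine ⟨h3 v (by rw [hverts]; simp [h1, h2]), fun h => h5 v (fun hi => h (hout v hi))⟩)
  exact ⟨φ, fun v => hφ.1 v (Finset.mem_univ v),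
    fun u w huw => hφ.2 u (Finset.mem_univ u) w (Finset.mem_univ w) huw⟩
end
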